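/- arXiv:0904.0561 — 3 statements merged into one kernel-verified Lean document; each statement's English description precedes it below -/
import Mathlib

section
/- Let s ≥ 1 and let a_1, …, a_{2s+2} be nonzero complex numbers such that a_i² ≠ 1 for 1 ≤ i ≤ s and e(a_i;a_k) ≠ 0 (equivalently a_i ≠ a_k and a_i a_k ≠ 1) for 1 ≤ i < k ≤ s. Set F(z) := ∏_{m=1}^{2s+2} (a_m − z) and G(z) := ∏_{m=1}^{2s+2} (1 − a_m z). Then for every z ∈ ℂ* with z² ≠ 1 one has the identity (F(z) − G(z)) / (z^{s+1}(z − z^{−1})) = C_0 · ∏_{i=1}^s e(z;a_i) + ∑_{i=1}^s C_i · ∏_{1≤k≤s, k≠i} e(z;a_k), where C_0 = 1 − a_1 a_2 ⋯ a_{2s+2} and C_i = ∏_{m=1}^{2s+2} (1 − a_i a_m) / ( a_i^s (1 − a_i²) ∏_{1≤k≤s, k≠i} e(a_i;a_k) ). -/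
open Complex Finset

noncomputable section

/-- `e(x;y) = x + x⁻¹ - (y + y⁻¹)`. -/
def efn (x y : ℂ) : ℂ := x + x⁻¹ - (y + y⁻¹)

/-- The inclusion `{1,…,s} ⊆ {1,…,2s+2}`. -/
def inc (s : ℕ) : Fin s → Fin (2 * s + 2) := Fin.castLE (by omega)

theorem efn_inv_left (x y : ℂ) : efn x⁻¹ y = efn x y := by
  simp only [efn, inv_inv]
  ring

theorem efn_self (x : ℂ) : efn x x = 0 := sub_self _

theorem efn_inv_self (x : ℂ) : efn x⁻¹ x = 0 := by
  rw [efn_inv_left, efn_self]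

/-- The function `c₀ ∏_i e(z;b_i) + ∑_i c_i ∏_{k≠i} e(z;b_k)`. -/
def efnExpansion {s : ℕ} (b : Fin s → ℂ) (c₀ : ℂ) (c : Fin s → ℂ) (z : ℂ) : ℂ :=
  c₀ * ∏ i, efn z (b i) + ∑ i, c i * ∏ k ∈ univ.erase i, efn z (b k)

theorem efnExpansion_inv {s : ℕ} (b : Fin s → ℂ) (c₀ : ℂ) (c : Fin s → ℂ) (z : ℂ) :
    efnExpansion b c₀ c z⁻¹ = efnExpansion b c₀ c z := by
  simp only [efnExpansion, efn_inv_left]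

theorem efnExpansion_node {s : ℕ} (b : Fin s → ℂ) (c₀ : ℂ) (c : Fin s → ℂ) (i : Fin s) :
    efnExpansion b c₀ c (b i) = c i * ∏ k ∈ univ.erase i, efn (b i) (b k) := by
  rw [efnExpansion, prod_eq_zero (mem_univ i) (efn_self _), mul_zero, zero_add]
  refine sum_eq_single i (fun j _ hj => ?_) (by simp)
  rw [prod_eq_zero (mem_erase.2 ⟨hj.symm, mem_univ i⟩) (efn_self _), mul_zero]

/-- The polynomial `z * e(z;y)` in `z`. -/
def efnPoly (y : ℂ) : Polynomial ℂ :=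
  Polynomial.X ^ 2 - Polynomial.C (y + y⁻¹) * Polynomial.X + 1

theorem eval_efnPoly {z : ℂ} (hz : z ≠ 0) (y : ℂ) : (efnPoly y).eval z = z * efn z y := by
  simp only [efnPoly, efn, Polynomial.eval_add, Polynomial.eval_sub, Polynomial.eval_pow,
    Polynomial.eval_X, Polynomial.eval_mul, Polynomial.eval_C, Polynomial.eval_one]
  linear_combination -mul_inv_cancel₀ hz

theorem natDegree_efnPoly_le (y : ℂ) : (efnPoly y).natDegree ≤ 2 := by
  unfold efnPoly
  compute_degree

theorem coeff_two_efnPoly (y : ℂ) : (efnPoly y).coeff 2 = 1 := by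
  simp [efnPoly, Polynomial.coeff_one]

/-- The polynomial `z ^ s` times `efnExpansion b c₀ c z`. -/
def efnExpansionPoly {s : ℕ} (b : Fin s → ℂ) (c₀ : ℂ) (c : Fin s → ℂ) : Polynomial ℂ :=
  Polynomial.C c₀ * ∏ i, efnPoly (b i) +
    ∑ i, Polynomial.C (c i) * (Polynomial.X * ∏ k ∈ univ.erase i, efnPoly (b k))

theorem eval_efnExpansionPoly {s : ℕ} (b : Fin s → ℂ) (c₀ : ℂ) (c : Fin s → ℂ) {z : ℂ}
    (hz : z ≠ 0) : (efnExpansionPoly b c₀ c).eval z = z ^ s * efnExpansion b c₀ c z := by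
  have key (i : Fin s) : z * ∏ k ∈ univ.erase i, z * efn z (b k) =
      z ^ s * ∏ k ∈ univ.erase i, efn z (b k) := by
    rw [prod_mul_distrib, prod_const, card_erase_of_mem (mem_univ i), card_univ, Fintype.card_fin,
      ← mul_assoc, mul_pow_sub_one (Fin.pos i).ne']
  simp only [efnExpansionPoly, efnExpansion, Polynomial.eval_add, Polynomial.eval_mul,
    Polynomial.eval_C, Polynomial.eval_prod, Polynomial.eval_finsetSum, Polynomial.eval_X,
    eval_efnPoly hz, key, mul_add, mul_sum]
  rw [prod_mul_distrib, prod_const, card_univ, Fintype.card_fin]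
  simp only [mul_left_comm]

theorem natDegree_X_mul_prod_erase_efnPoly_lt {s : ℕ} (b : Fin s → ℂ) (i : Fin s) :
    (Polynomial.X * ∏ k ∈ univ.erase i, efnPoly (b k)).natDegree < s * 2 := by
  have h := (Polynomial.natDegree_prod_le (univ.erase i) fun k => efnPoly (b k)).trans
    (sum_le_card_nsmul _ _ 2 fun k _ => natDegree_efnPoly_le (b k))
  rw [card_erase_of_mem (mem_univ i), card_univ, Fintype.card_fin, smul_eq_mul] at h
  have h' := Polynomial.natDegree_mul_le (p := (Polynomial.X : Polynomial ℂ))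
    (q := ∏ k ∈ univ.erase i, efnPoly (b k))
  rw [Polynomial.natDegree_X] at h'
  have := Fin.pos i
  omega

theorem natDegree_efnExpansionPoly_le {s : ℕ} (b : Fin s → ℂ) (c₀ : ℂ) (c : Fin s → ℂ) :
    (efnExpansionPoly b c₀ c).natDegree ≤ s * 2 := by
  refine Polynomial.natDegree_add_le_of_degree_le ?_ ?_
  · refine (Polynomial.natDegree_C_mul_le _ _).trans ((Polynomial.natDegree_prod_le _ _).trans ?_)
    simpa using sum_le_card_nsmul univ _ 2 fun k _ => natDegree_efnPoly_le (b k)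
  · exact Polynomial.natDegree_sum_le_of_forall_le _ _ fun i _ =>
      (Polynomial.natDegree_C_mul_le _ _).trans (natDegree_X_mul_prod_erase_efnPoly_lt b i).le

theorem coeff_efnExpansionPoly {s : ℕ} (b : Fin s → ℂ) (c₀ : ℂ) (c : Fin s → ℂ) :
    (efnExpansionPoly b c₀ c).coeff (s * 2) = c₀ := by
  have h := Polynomial.coeff_prod_of_natDegree_le (s := univ) (fun i => efnPoly (b i)) 2
    fun i _ => natDegree_efnPoly_le (b i)
  simp only [card_univ, Fintype.card_fin, coeff_two_efnPoly, prod_const_one] at h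
  simp [efnExpansionPoly, Polynomial.coeff_C_mul, h,
    Polynomial.coeff_eq_zero_of_natDegree_lt (natDegree_X_mul_prod_erase_efnPoly_lt b _)]

/-- The polynomial `∏_m (a_m - z) - ∏_m (1 - a_m z)`. -/
def prodDiffPoly {n : ℕ} (a : Fin n → ℂ) : Polynomial ℂ :=
  (∏ m, (Polynomial.C (a m) - Polynomial.X)) - ∏ m, (1 - Polynomial.C (a m) * Polynomial.X)

theorem eval_prodDiffPoly {n : ℕ} (a : Fin n → ℂ) (z : ℂ) :
    (prodDiffPoly a).eval z = (∏ m, (a m - z)) - ∏ m, (1 - a m * z) := by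
  simp [prodDiffPoly, Polynomial.eval_prod]

theorem natDegree_prodDiffPoly_le {n : ℕ} (a : Fin n → ℂ) : (prodDiffPoly a).natDegree ≤ n := by
  have h (f : Fin n → Polynomial ℂ) (hf : ∀ m, (f m).natDegree ≤ 1) : (∏ m, f m).natDegree ≤ n :=
    (Polynomial.natDegree_prod_le _ _).trans
      ((sum_le_card_nsmul univ _ 1 fun m _ => hf m).trans (by simp))
  refine (Polynomial.natDegree_sub_le _ _).trans (max_le (h _ fun m => ?_) (h _ fun m => ?_)) <;>
    compute_degree

theorem coeff_prodDiffPoly {n : ℕ} (hn : Even n) (a : Fin n → ℂ) :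
    (prodDiffPoly a).coeff n = 1 - ∏ m, a m := by
  have h₁ := Polynomial.coeff_prod_of_natDegree_le (s := univ)
    (fun m => Polynomial.C (a m) - Polynomial.X) 1 fun m _ => by compute_degree
  have h₂ := Polynomial.coeff_prod_of_natDegree_le (s := univ)
    (fun m => 1 - Polynomial.C (a m) * Polynomial.X) 1 fun m _ => by compute_degree
  simp [Polynomial.coeff_one, Polynomial.coeff_C, prod_neg, hn.neg_one_pow] at h₁ h₂
  rw [prodDiffPoly, Polynomial.coeff_sub, h₁, h₂]

theorem eval_prodDiffPoly_inv {n : ℕ} (hn : Even n) (a : Fin n → ℂ) {z : ℂ} (hz : z ≠ 0) :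
    z ^ n * (prodDiffPoly a).eval z⁻¹ = -(prodDiffPoly a).eval z := by
  have h₁ : z ^ n * ∏ m, (a m - z⁻¹) = ∏ m, (1 - a m * z) := by
    have h : ∏ m, -(1 - a m * z) = ∏ m, (1 - a m * z) := by
      simp only [prod_neg, card_univ, Fintype.card_fin, hn.neg_one_pow, one_mul]
    rw [← h, ← Fin.prod_const, ← prod_mul_distrib]
    exact prod_congr rfl fun m _ => by field_simp; ring
  have h₂ : z ^ n * ∏ m, (1 - a m * z⁻¹) = ∏ m, (a m - z) := by
    have h : ∏ m, -(a m - z) = ∏ m, (a m - z) := by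
      simp only [prod_neg, card_univ, Fintype.card_fin, hn.neg_one_pow, one_mul]
    rw [← h, ← Fin.prod_const, ← prod_mul_distrib]
    exact prod_congr rfl fun m _ => by field_simp; ring
  rw [eval_prodDiffPoly, eval_prodDiffPoly, mul_sub, h₁, h₂]
  ring

/-- The points `±1`, `b_i`, `b_i⁻¹`. -/
def nodes {s : ℕ} (b : Fin s → ℂ) : (Fin s ⊕ Fin s) ⊕ Bool → ℂ :=
  Sum.elim (Sum.elim b fun i => (b i)⁻¹) fun t => if t then 1 else -1

theorem nodes_injective {s : ℕ} (b : Fin s → ℂ) (hb : ∀ i, b i ≠ 0) (hsq : ∀ i, b i ^ 2 ≠ 1)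
    (he : ∀ i k, i ≠ k → efn (b i) (b k) ≠ 0) : Function.Injective (nodes b) := by
  have hinj : Function.Injective b := fun i k h => by
    by_contra hik
    exact he i k hik (h ▸ efn_self _)
  have hinv (i k : Fin s) : b i ≠ (b k)⁻¹ := fun h => by
    by_cases hik : i = k
    · subst hik
      exact hsq i (by rw [sq]; nth_rewrite 2 [h]; exact mul_inv_cancel₀ (hb i))
    · exact he i k hik (h ▸ efn_inv_self _)
  refine Function.Injective.sumElim (Function.Injective.sumElim hinj
    (inv_injective.comp hinj) hinv) ?_ ?_
  · intro t u
    cases t <;> cases u <;> norm_num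
  · rintro (i | i) t h
    · apply hsq i
      simp only [Sum.elim_inl] at h
      rw [h]
      split_ifs <;> norm_num
    · apply hsq i
      simp only [Sum.elim_inr] at h
      rw [inv_eq_iff_eq_inv.1 h]
      split_ifs <;> norm_num

/-- The partial-fraction expansion
`(F(z) - G(z))/(z^(s+1)(z - z⁻¹)) = C₀ ∏_i e(z;a_i) + ∑_i C_i ∏_{k≠i} e(z;a_k)`. -/
theorem stmt2 (s : ℕ) (hs : 1 ≤ s) (a : Fin (2 * s + 2) → ℂ)
    (ha0 : ∀ m, a m ≠ 0)
    (hsq : ∀ i : Fin s, a (inc s i) ^ 2 ≠ 1)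
    (he : ∀ i k : Fin s, i ≠ k → efn (a (inc s i)) (a (inc s k)) ≠ 0) :
    ∀ z : ℂ, z ≠ 0 → z ^ 2 ≠ 1 →
      ((∏ m, (a m - z)) - ∏ m, (1 - a m * z)) / (z ^ (s + 1) * (z - z⁻¹)) =
        (1 - ∏ m, a m) * ∏ i : Fin s, efn z (a (inc s i)) +
          ∑ i : Fin s,
            ((∏ m, (1 - a (inc s i) * a m)) /
                (a (inc s i) ^ s * (1 - a (inc s i) ^ 2) *
                  ∏ k ∈ univ.erase i, efn (a (inc s i)) (a (inc s k)))) *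
              ∏ k ∈ univ.erase i, efn z (a (inc s k)) := by
  intro z hz hz1
  set b : Fin s → ℂ := fun i => a (inc s i)
  have hb0 (i : Fin s) : b i ≠ 0 := ha0 _
  set c : Fin s → ℂ := fun i => (∏ m, (1 - b i * a m)) /
    (b i ^ s * (1 - b i ^ 2) * ∏ k ∈ univ.erase i, efn (b i) (b k)) with hc
  set c₀ : ℂ := 1 - ∏ m, a m with hc₀
  change _ = efnExpansion b c₀ c z
  have heven : Even (2 * s + 2) := ⟨s + 1, by ring⟩
  set D : Polynomial ℂ :=
    prodDiffPoly a - (Polynomial.X ^ 2 - 1) * efnExpansionPoly b c₀ c with hD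
  have hDeval {w : ℂ} (hw : w ≠ 0) : D.eval w =
      (prodDiffPoly a).eval w - (w ^ 2 - 1) * (w ^ s * efnExpansion b c₀ c w) := by
    simp [hD, eval_efnExpansionPoly b c₀ c hw]
  have hDinv {w : ℂ} (hw : w ≠ 0) : w ^ (2 * s + 2) * D.eval w⁻¹ = -D.eval w := by
    rw [hDeval hw, hDeval (inv_ne_zero hw), mul_sub, eval_prodDiffPoly_inv heven a hw,
      efnExpansion_inv]
    have h : w ^ (2 * s + 2) * ((w⁻¹ ^ 2 - 1) * w⁻¹ ^ s) = -((w ^ 2 - 1) * w ^ s) := by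
      rw [pow_add, two_mul, pow_add, inv_pow, inv_pow]
      field_simp
      ring
    linear_combination -efnExpansion b c₀ c w * h
  have hnode (i : Fin s) : D.eval (b i) = 0 := by
    have h₁ : ∏ m, (a m - b i) = 0 := prod_eq_zero (mem_univ (inc s i)) (sub_self _)
    have h₂ : ∏ m, (1 - a m * b i) = ∏ m, (1 - b i * a m) := by simp only [mul_comm]
    have h₃ : ∏ k ∈ univ.erase i, efn (b i) (b k) ≠ 0 :=
      prod_ne_zero_iff.2 fun k hk => he i k (ne_of_mem_erase hk).symm
    have h₄ : 1 - b i ^ 2 ≠ 0 := sub_ne_zero.2 (hsq i).symm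
    have h₅ := hb0 i
    rw [hDeval h₅, eval_prodDiffPoly, h₁, h₂, efnExpansion_node]
    simp only [hc]
    field_simp
    ring
  have hroot (x) : D.eval (nodes b x) = 0 := by
    rcases x with (i | i) | t
    · exact hnode i
    · have h := hDinv (hb0 i)
      rw [hnode i, neg_zero] at h
      exact (mul_eq_zero.1 h).resolve_left (pow_ne_zero _ (hb0 i))
    · have hw : (if t then (1 : ℂ) else -1) ≠ 0 := by split_ifs <;> norm_num
      have h := hDinv hw
      have hinv : (if t then (1 : ℂ) else -1)⁻¹ = if t then (1 : ℂ) else -1 := by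
        split_ifs <;> norm_num
      have hpow : (if t then (1 : ℂ) else -1) ^ (2 * s + 2) = 1 := by
        split_ifs <;> simp [heven.neg_one_pow]
      rw [hinv, hpow, one_mul] at h
      exact self_eq_neg.1 h
  have hX : (Polynomial.X ^ 2 - 1 : Polynomial ℂ).natDegree ≤ 2 := by compute_degree
  have hdeg : D.natDegree < 2 * s + 2 := by
    have hle : D.natDegree ≤ 2 * s + 2 :=
      (Polynomial.natDegree_sub_le _ _).trans (max_le (natDegree_prodDiffPoly_le a)
        ((Polynomial.natDegree_mul_le_of_le hX (natDegree_efnExpansionPoly_le b c₀ c)).trans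
          (by omega)))
    have hcoeff : D.coeff (2 * s + 2) = 0 := by
      rw [hD, Polynomial.coeff_sub, coeff_prodDiffPoly heven, ← hc₀,
        show 2 * s + 2 = 2 + s * 2 by ring,
        Polynomial.coeff_mul_add_eq_of_natDegree_le hX (natDegree_efnExpansionPoly_le b c₀ c),
        coeff_efnExpansionPoly]
      simp [Polynomial.coeff_one]
    refine hle.lt_of_ne fun h => ?_
    rw [← h, Polynomial.coeff_natDegree, Polynomial.leadingCoeff_eq_zero] at hcoeff
    simp [hcoeff] at h
  have hD0 : D = 0 := Polynomial.eq_zero_of_natDegree_lt_card_of_eval_eq_zero D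
    (nodes_injective b hb0 hsq he) hroot (by simp; omega)
  have hfin := hDeval hz
  rw [hD0, Polynomial.eval_zero, eval_prodDiffPoly] at hfin
  have hden : z ^ (s + 1) * (z - z⁻¹) = (z ^ 2 - 1) * z ^ s := by
    field_simp
    ring
  rw [hden, div_eq_iff (mul_ne_zero (sub_ne_zero.2 hz1) (pow_ne_zero _ hz))]
  linear_combination -hfin
end
end

section
/- Suppose a_1 a_2 ⋯ a_{2s+2} ≠ 1, let i_1, …, i_{s−1} ∈ {1,…,2s+2} be distinct and j ∉ {i_1,…,i_{s−1}}, with generic parameters (all denominators nonzero, Θ(ξ) ≠ 0) and absolute convergence of all Jackson integrals. Then T_{a_j}(⟨⟨v_0,ξ⟩⟩, …, ⟨⟨v_{s−1},ξ⟩⟩) = (⟨⟨v_0,ξ⟩⟩, …, ⟨⟨v_{s−1},ξ⟩⟩) B̄, where B̄ = (−1/a_j) U L with U, L the matrices built from c_0 = ∏_{m=1}^{2s+2} (1 − a_j a_m)/( (−a_j)^s (1 − a_1⋯a_{2s+2})(1 − a_j²) ∏_{ℓ=1}^{s−1} e(a_{i_ℓ};a_j) ), c_k = e(a_{i_k};a_j),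 d_k = ∏_{m=1}^{2s+2} (1 − a_{i_k} a_m)/( (−a_{i_k})^s (1 − a_1⋯a_{2s+2})(1 − a_{i_k}²) e(a_j;a_{i_k}) ∏_{ℓ≠k} e(a_{i_ℓ};a_{i_k}) ) (U upper triangular with diagonal (c_0,c_1,…,c_{s−1}) and first row (c_0,1,…,1); L lower triangular with unit diagonal and first column (1,d_1,…,d_{s−1})). In particular −c_0/a_j = ∏_{m=1}^{2s+2} (1 − a_j^{−1} a_m^{−1}) / ( (1 − a_1^{−1}⋯a_{2s+2}^{−1})(1 − a_j^{−2}) ∏_{ℓ=1}^{s−1} (1 − a_{i_ℓ} a_j^{−1})(1 − a_{i_ℓ}^{−1} a_j^{−1}) ), −c_k/a_j = (1 − a_{i_k} a_j^{−1})(1 − a_{i_k}^{−1} a_j^{−1}), and det B̄ = ∏_{m=1}^{2s+2} (1 − a_j^{−1} a_m^{−1}) / ( (1 − a_j^{−2})(1 − a_1^{−1} a_2^{−1} ⋯ a_{2s+2}^{−1}) ). -/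
open Complex Finset

noncomputable section

/-- The `q`-shifted factorial `(x;q)_∞ = ∏_{i≥0} (1 - q^i x)`. -/
def qp (q : ℝ) (x : ℂ) : ℂ := ∏' i : ℕ, (1 - (q : ℂ) ^ i * x)

/-- The theta function `θ(x) = (x;q)_∞ (q/x;q)_∞`. -/
def th (q : ℝ) (x : ℂ) : ℂ := qp q x * qp q ((q : ℂ) / x)

/-- The value `Φ(q^ν ξ)` of the `BC₁` weight along the `q`-lattice through `ξ`,
where the power `(q^ν ξ)^(1/2 - α m)` is interpreted as
`q^(ν/2) * (a m)^(-ν) * ξ^(1/2 - α m)` for the fixed (principal) branch of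
`ξ^(1/2 - α m)`. -/
def PhiLat (q : ℝ) (s : ℕ) (a α : Fin (2 * s + 2) → ℂ) (ξ : ℂ) (ν : ℤ) : ℂ :=
  ∏ m, ((q : ℂ) ^ ((ν : ℂ) / 2) * a m ^ (-ν) * ξ ^ ((1 : ℂ) / 2 - α m) *
    (qp q ((q : ℂ) * ((q : ℂ) ^ ν * ξ) / a m) / qp q ((q : ℂ) ^ ν * ξ * a m)))

/-- The `ν`-th summand `φ(q^ν ξ) Φ(q^ν ξ) Δ(q^ν ξ)` of the `BC₁`-type Jackson
integral `⟨φ,ξ⟩`. -/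
def jSummand (q : ℝ) (s : ℕ) (a α : Fin (2 * s + 2) → ℂ) (φ : ℂ → ℂ) (ξ : ℂ) (ν : ℤ) : ℂ :=
  φ ((q : ℂ) ^ ν * ξ) * PhiLat q s a α ξ ν * (((q : ℂ) ^ ν * ξ)⁻¹ - (q : ℂ) ^ ν * ξ)

/-- The `BC₁`-type Jackson integral `⟨φ,ξ⟩ = (1-q) ∑_{ν∈ℤ} φ(q^ν ξ) Φ(q^ν ξ) Δ(q^ν ξ)`. -/
def jInt (q : ℝ) (s : ℕ) (a α : Fin (2 * s + 2) → ℂ) (φ : ℂ → ℂ) (ξ : ℂ) : ℂ :=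
  (1 - (q : ℂ)) * ∑' ν : ℤ, jSummand q s a α φ ξ ν

/-- `Θ(z) = z^(s - α₁ - ⋯ - α_{2s+2}) θ(z²) / ∏_m θ(a_m z)`. -/
def ThetaBC (q : ℝ) (s : ℕ) (a α : Fin (2 * s + 2) → ℂ) (z : ℂ) : ℂ :=
  z ^ ((s : ℂ) - ∑ m, α m) * th q (z ^ 2) / ∏ m, th q (a m * z)

/-- The basis `{v₀, v₁, …, v_{s-1}}`: `v₀ = e_{i₁}⋯e_{i_{s-1}}`, and for `k ≥ 1`,
`v_k = e_{i₁}⋯ê_{i_k}⋯e_{i_{s-1}}`. -/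
def vBasis (s : ℕ) (a : Fin (2 * s + 2) → ℂ) (i : Fin (s - 1) → Fin (2 * s + 2))
    (k : Fin s) (z : ℂ) : ℂ :=
  if h : (k : ℕ) = 0 then ∏ l, efn z (a (i l))
  else ∏ l ∈ univ.erase (⟨(k : ℕ) - 1, by have := k.isLt; omega⟩ : Fin (s - 1)),
    efn z (a (i l))

/-- The diagonal entries `(c₀, c₁, …, c_{s-1})` of the matrix `U`. -/
def cEnt (s : ℕ) (a : Fin (2 * s + 2) → ℂ) (i : Fin (s - 1) → Fin (2 * s + 2))
    (j : Fin (2 * s + 2)) (k : Fin s) : ℂ :=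
  if h : (k : ℕ) = 0 then
    (∏ m, (1 - a j * a m)) /
      ((-a j) ^ s * (1 - ∏ m, a m) * (1 - a j ^ 2) * ∏ l, efn (a (i l)) (a j))
  else efn (a (i ⟨(k : ℕ) - 1, by have := k.isLt; omega⟩)) (a j)

/-- The first-column entries `(1, d₁, …, d_{s-1})` of the matrix `L`. -/
def dEnt (s : ℕ) (a : Fin (2 * s + 2) → ℂ) (i : Fin (s - 1) → Fin (2 * s + 2))
    (j : Fin (2 * s + 2)) (k : Fin s) : ℂ :=
  if h : (k : ℕ) = 0 then 1
  else
    (∏ m, (1 - a (i ⟨(k : ℕ) - 1, by have := k.isLt; omega⟩) * a m)) /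
      ((-a (i ⟨(k : ℕ) - 1, by have := k.isLt; omega⟩)) ^ s * (1 - ∏ m, a m) *
        (1 - a (i ⟨(k : ℕ) - 1, by have := k.isLt; omega⟩) ^ 2) *
        efn (a j) (a (i ⟨(k : ℕ) - 1, by have := k.isLt; omega⟩)) *
        ∏ l ∈ univ.erase (⟨(k : ℕ) - 1, by have := k.isLt; omega⟩ : Fin (s - 1)),
          efn (a (i l)) (a (i ⟨(k : ℕ) - 1, by have := k.isLt; omega⟩)))

/-- The upper triangular matrix `U` with diagonal `(c₀, c₁, …, c_{s-1})`,
first row `(c₀, 1, …, 1)` and all other entries `0`. -/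
def Umat (s : ℕ) (a : Fin (2 * s + 2) → ℂ) (i : Fin (s - 1) → Fin (2 * s + 2))
    (j : Fin (2 * s + 2)) : Matrix (Fin s) (Fin s) ℂ :=
  Matrix.of fun r c => if r = c then cEnt s a i j r else if (r : ℕ) = 0 then 1 else 0

/-- The lower triangular matrix `L` with unit diagonal, first column
`(1, d₁, …, d_{s-1})` and all other entries `0`. -/
def Lmat (s : ℕ) (a : Fin (2 * s + 2) → ℂ) (i : Fin (s - 1) → Fin (2 * s + 2))
    (j : Fin (2 * s + 2)) : Matrix (Fin s) (Fin s) ℂ :=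
  Matrix.of fun r c => if r = c then 1 else if (c : ℕ) = 0 then dEnt s a i j r else 0

/-- The functional equation `(x)_∞ = (1 - x) (q x)_∞`. -/
theorem qp_eq_mul {q : ℝ} (hq0 : 0 < q) (hq1 : q < 1) (x : ℂ) :
    qp q x = (1 - x) * qp q (q * x) := by
  have hm (y : ℂ) : Multipliable fun n : ℕ => 1 - (q : ℂ) ^ n * y := by
    have h : Summable fun n : ℕ => ‖-((q : ℂ) ^ n * y)‖ := by
      simp only [norm_neg, norm_mul, norm_pow, norm_real, Real.norm_eq_abs, abs_of_pos hq0]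
      exact (summable_geometric_of_lt_one hq0.le hq1).mul_right _
    simpa [sub_eq_add_neg] using multipliable_one_add_of_summable h
  have hs : ∀ n : ℕ, 1 - (q : ℂ) ^ (n + 1) * x = 1 - (q : ℂ) ^ n * (q * x) := fun n => by ring
  unfold qp
  rw [tprod_eq_zero_mul' (f := fun n : ℕ => 1 - (q : ℂ) ^ n * x)
    (by simpa only [hs] using hm (q * x))]
  simp only [hs, pow_zero, one_mul]

/-- A nonzero theta value forces the argument to avoid the lattice `q^ℤ`. -/
theorem zpow_mul_ne_one_of_th_ne_zero {q : ℝ} (hq0 : 0 < q) {x : ℂ}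
    (h : th q x ≠ 0) (ν : ℤ) : (q : ℂ) ^ ν * x ≠ 1 := by
  intro hν
  have hq : (q : ℂ) ≠ 0 := by exact_mod_cast hq0.ne'
  apply h
  unfold th qp
  rcases lt_or_ge ν 0 with hneg | hpos
  · obtain ⟨n, hn⟩ : ∃ n : ℕ, -ν = n + 1 := ⟨(-ν - 1).toNat, by omega⟩
    refine mul_eq_zero_of_right _ (tprod_of_exists_eq_zero ⟨n, ?_⟩)
    have : (q : ℂ) ^ n * (q / x) = ((q : ℂ) ^ ν * x)⁻¹ := by
      rw [mul_inv, ← zpow_neg, hn, zpow_add_one₀ hq, zpow_natCast]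
      ring
    rw [this, hν, inv_one, sub_self]
  · lift ν to ℕ using hpos
    refine mul_eq_zero_of_left (tprod_of_exists_eq_zero ⟨ν, ?_⟩) _
    rw [zpow_natCast] at hν
    rw [hν, sub_self]

/-- Quasi-periodicity `θ(q x) = -x⁻¹ θ(x)`. -/
theorem th_q_mul {q : ℝ} (hq0 : 0 < q) (hq1 : q < 1) {x : ℂ} (hx : x ≠ 0) :
    th q (q * x) = -x⁻¹ * th q x := by
  have hq : (q : ℂ) ≠ 0 := by exact_mod_cast hq0.ne'
  have h1 := qp_eq_mul hq0 hq1 x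
  have h2 := qp_eq_mul hq0 hq1 x⁻¹
  have h3 : (q : ℂ) / (q * x) = x⁻¹ := by field_simp
  unfold th
  rw [h3, h2, h1, ← div_eq_mul_inv]
  field_simp
  ring

/-- Factorization of `e(z;y)` in the variable `z`. -/
theorem efn_eq {z y : ℂ} (hz : z ≠ 0) (hy : y ≠ 0) :
    efn z y = z⁻¹ * ((z - y) * (z - y⁻¹)) := by
  unfold efn
  field_simp
  ring

theorem efn_swap (x y : ℂ) : efn x y = -efn y x := by
  unfold efn
  ring

open Polynomial in
/-- Interpolation at the points `a (κ k)`, `(a (κ k))⁻¹`, `1`, `-1`. -/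
theorem prod_sub_prod_eq {s : ℕ} (a : Fin (2 * s + 2) → ℂ) (κ : Fin s → Fin (2 * s + 2))
    (h0 : ∀ m, a m ≠ 0) (h2 : ∀ k, a (κ k) ^ 2 ≠ 1)
    (he : ∀ k l, k ≠ l → efn (a (κ k)) (a (κ l)) ≠ 0) (z : ℂ) :
    ∏ m, (a m - z) - ∏ m, (1 - z * a m) =
      (z ^ 2 - 1) * ((1 - ∏ m, a m) * ∏ k, ((z - a (κ k)) * (z - (a (κ k))⁻¹)) -
        z * ∑ k, (∏ m, (1 - a (κ k) * a m)) / ((-a (κ k)) ^ s * (1 - a (κ k) ^ 2) *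
          ∏ l ∈ univ.erase k, efn (a (κ l)) (a (κ k))) *
          ∏ l ∈ univ.erase k, ((z - a (κ l)) * (z - (a (κ l))⁻¹))) := by
  set b : Fin s → ℂ := fun k => a (κ k) with hb
  have hb0 : ∀ k, b k ≠ 0 := fun k => h0 _
  set D : Fin s → ℂ := fun k => (∏ m, (1 - b k * a m)) / ((-b k) ^ s * (1 - b k ^ 2) *
          ∏ l ∈ univ.erase k, efn (b l) (b k)) with hD
  let Q : Fin s → ℂ[X] := fun k => (X - C (b k)) * (X - C (b k)⁻¹)
  let p : ℂ[X] := ∏ m, (C (a m) - X) - ∏ m, (1 - X * C (a m)) -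
    (X ^ 2 - 1) * (C (1 - ∏ m, a m) * ∏ k, Q k - X * ∑ k, C (D k) * ∏ l ∈ univ.erase k, Q l)
  have hQ : ∀ k, (Q k).natDegree ≤ 2 := fun k => by
    refine natDegree_mul_le_of_le (m := 1) (n := 1) ?_ ?_ <;> exact natDegree_X_sub_C_le _
  have hQc : ∀ k, (Q k).coeff 2 = 1 := fun k => by
    have : (Q k).Monic := (monic_X_sub_C _).mul (monic_X_sub_C _)
    rw [← this.coeff_natDegree]
    congr 1
    rw [(monic_X_sub_C _).natDegree_mul (monic_X_sub_C _)]
    simp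
  have hpz : p = 0 := by
    have hprod : ∀ t : Finset (Fin s), (∏ l ∈ t, Q l).natDegree ≤ #t * 2 := fun t =>
      (natDegree_prod_le _ _).trans (sum_le_card_nsmul _ _ _ fun k _ => hQ k)
    have hdegA : ∀ m, (C (a m) - X : ℂ[X]).natDegree ≤ 1 := fun m =>
      (natDegree_sub_le_of_le (m := 0) (n := 1) (by simp) (by simp)).trans (by simp)
    have hdegB : ∀ m, (1 - X * C (a m) : ℂ[X]).natDegree ≤ 1 := fun m =>
      (natDegree_sub_le_of_le (m := 0) (n := 1) (by simp)
        (natDegree_mul_le_of_le (m := 1) (n := 0) (by simp) (by simp))).trans (by simp)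
    have hdegS : (X ^ 2 - 1 : ℂ[X]).natDegree ≤ 2 :=
      (natDegree_sub_le_of_le (m := 2) (n := 0) (by simp) (by simp)).trans (by simp)
    have hdegT : (X * ∑ k, C (D k) * ∏ l ∈ univ.erase k, Q l).natDegree ≤ 2 * s - 1 := by
      rw [mul_sum]
      refine natDegree_sum_le_of_forall_le _ _ fun k _ => ?_
      have hk := hprod (univ.erase k)
      rw [card_erase_of_mem (mem_univ k), card_univ, Fintype.card_fin] at hk
      have h := natDegree_mul_le_of_le (natDegree_X_le (R := ℂ))
        ((natDegree_C_mul_le (D k) (∏ l ∈ univ.erase k, Q l)).trans hk)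
      have := k.isLt
      omega
    have hcT : (X * ∑ k, C (D k) * ∏ l ∈ univ.erase k, Q l).coeff (s * 2) = 0 := by
      rcases Nat.eq_zero_or_pos s with rfl | hs
      · simp
      · exact coeff_eq_zero_of_natDegree_lt (by omega)
    have hdegR : (C (1 - ∏ m, a m) * ∏ k, Q k -
        X * ∑ k, C (D k) * ∏ l ∈ univ.erase k, Q l).natDegree ≤ s * 2 := by
      refine (natDegree_sub_le_of_le (m := s * 2) (n := s * 2) ?_ (by omega)).trans (by simp)
      exact (natDegree_C_mul_le _ _).trans (by simpa using hprod univ)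
    have hdeg : p.natDegree ≤ 2 * s + 2 := by
      refine (natDegree_sub_le_of_le (m := 2 * s + 2) (n := 2 * s + 2)
        ((natDegree_sub_le_of_le (m := 2 * s + 2) (n := 2 * s + 2) ?_ ?_).trans
          (by simp)) ?_).trans (by simp)
      · exact (natDegree_prod_le _ _).trans
          ((sum_le_card_nsmul _ _ _ fun m _ => hdegA m).trans (by simp))
      · exact (natDegree_prod_le _ _).trans
          ((sum_le_card_nsmul _ _ _ fun m _ => hdegB m).trans (by simp))
      · exact (natDegree_mul_le_of_le hdegS hdegR).trans (by omega)
    have hcoeff : p.coeff (2 * s + 2) = 0 := by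
      have hA : (∏ m, (C (a m) - X)).coeff (2 * s + 2) = 1 := by
        have := coeff_prod_of_natDegree_le (s := univ) (fun m => C (a m) - X) 1
          fun m _ => hdegA m
        simpa [coeff_C, pow_add, pow_mul] using this
      have hB : (∏ m, (1 - X * C (a m))).coeff (2 * s + 2) = ∏ m, a m := by
        have := coeff_prod_of_natDegree_le (s := univ) (fun m => 1 - X * C (a m)) 1
          fun m _ => hdegB m
        simpa [coeff_one, prod_neg, pow_add, pow_mul] using this
      have hC : (∏ k, Q k).coeff (s * 2) = 1 := by
        have := coeff_prod_of_natDegree_le (s := univ) Q 2 fun k _ => hQ k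
        simpa [hQc] using this
      have hM := coeff_mul_add_eq_of_natDegree_le hdegS hdegR
      rw [show 2 + s * 2 = 2 * s + 2 by ring] at hM
      simp only [p, coeff_sub, hA, hB, hM, hC, hcT, coeff_C_mul]
      simp [coeff_one]
    let f : (Fin s ⊕ Fin s) ⊕ Bool → ℂ :=
      Sum.elim (Sum.elim b fun k => (b k)⁻¹) fun t => if t then 1 else -1
    have hinj : Function.Injective b := fun k l hkl => by
      by_contra hne
      exact he k l hne (by change efn (b k) (b l) = 0; rw [hkl, efn_self])
    have hbi : ∀ k l, b k ≠ (b l)⁻¹ := fun k l hkl => by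
      rcases eq_or_ne k l with rfl | hne
      · apply h2 k
        change b k ^ 2 = 1
        rw [sq]
        nth_rewrite 1 [hkl]
        exact inv_mul_cancel₀ (hb0 k)
      · exact he k l hne (by change efn (b k) (b l) = 0; rw [hkl, efn_inv_left, efn_self])
    have hf : Function.Injective f := by
      refine Function.Injective.sumElim (Function.Injective.sumElim hinj
        (fun k l hkl => hinj (inv_injective hkl)) hbi) ?_ ?_
      · intro t u
        cases t <;> cases u <;> norm_num
      · rintro (k | k) t htk
        · apply h2 k
          change b k ^ 2 = 1
          rw [show b k = _ from htk]
          cases t <;> simp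
        · apply h2 k
          change b k ^ 2 = 1
          rw [show b k = _ from inv_eq_iff_eq_inv.mp htk]
          cases t <;> simp
    refine eq_zero_of_natDegree_lt_card_of_eval_eq_zero p hf ?_ ?_
    · have hsum : ∀ k (w : ℂ), (w - b k) * (w - (b k)⁻¹) = 0 →
          ∑ r, D r * ∏ l ∈ univ.erase r, ((w - b l) * (w - (b l)⁻¹)) =
            D k * ∏ l ∈ univ.erase k, ((w - b l) * (w - (b l)⁻¹)) := fun k w hw =>
        sum_eq_single k (fun r _ hr => by
          rw [prod_eq_zero (mem_erase.mpr ⟨hr.symm, mem_univ k⟩) hw, mul_zero]) (by simp)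
      have hfac : ∀ k, D k * ((1 - b k ^ 2) * (-b k) ^ s *
          ∏ l ∈ univ.erase k, efn (b l) (b k)) = ∏ m, (1 - b k * a m) := fun k => by
        have h1 : (1 - b k ^ 2) ≠ 0 := sub_ne_zero.mpr (h2 k).symm
        have h3 : ∏ l ∈ univ.erase k, efn (b l) (b k) ≠ 0 :=
          prod_ne_zero_iff.mpr fun l hl => he l k (ne_of_mem_erase hl)
        have h4 : (-b k) ^ s ≠ 0 := pow_ne_zero _ (neg_ne_zero.mpr (hb0 k))
        simp only [hD]
        field_simp
      have hpe : ∀ k (w : ℂ), w ≠ 0 → efn w = efn (b k) →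
          ∏ l ∈ univ.erase k, ((w - b l) * (w - (b l)⁻¹)) =
            (-w) ^ (s - 1) * ∏ l ∈ univ.erase k, efn (b l) (b k) := fun k w hw hwe => by
        have hc : #(univ.erase k) = s - 1 := by simp
        rw [← hc, ← prod_const, ← prod_mul_distrib]
        refine prod_congr rfl fun l _ => ?_
        rw [efn_swap, ← hwe, efn_eq hw (hb0 l)]
        field_simp
      have hpow : ∀ (k : Fin s) (w : ℂ), (-w) ^ s = -w * (-w) ^ (s - 1) := fun k w => by
        have := k.isLt
        rw [← pow_succ', Nat.sub_add_cancel (by omega)]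
      rintro ((k | k) | t)
      · have hz : (b k - b k) * (b k - (b k)⁻¹) = 0 := by simp
        simp only [f, Sum.elim_inl, p, Q, eval_sub, eval_mul, eval_prod, eval_X, eval_C,
          eval_one, eval_pow, eval_finsetSum]
        rw [hsum k _ hz, hpe k _ (hb0 k) rfl, prod_eq_zero (mem_univ k) hz,
          prod_eq_zero (mem_univ (κ k)) (sub_self (b k)), ← hfac k, hpow k]
        ring
      · have hz : ((b k)⁻¹ - b k) * ((b k)⁻¹ - (b k)⁻¹) = 0 := by simp
        have hz' : 1 - (b k)⁻¹ * a (κ k) = 0 := by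
          change 1 - (b k)⁻¹ * b k = 0
          rw [inv_mul_cancel₀ (hb0 k), sub_self]
        have hp1 : ∏ m, (a m - (b k)⁻¹) =
            ((b k)⁻¹) ^ (2 * s + 2) * ∏ m, (1 - b k * a m) := by
          have : ∏ _m : Fin (2 * s + 2), -(b k)⁻¹ = ((b k)⁻¹) ^ (2 * s + 2) := by
            simp [pow_add, pow_mul]
          rw [← this, ← prod_mul_distrib]
          refine prod_congr rfl fun m _ => ?_
          have := hb0 k
          field_simp
          ring
        simp only [f, Sum.elim_inl, Sum.elim_inr, p, Q, eval_sub, eval_mul, eval_prod, eval_X,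
          eval_C, eval_one, eval_pow, eval_finsetSum]
        rw [hsum k _ hz, hpe k _ (inv_ne_zero (hb0 k)) (funext (efn_inv_left _)),
          prod_eq_zero (mem_univ k) hz, 
          prod_eq_zero (f := fun m => 1 - (b k)⁻¹ * a m) (mem_univ (κ k)) hz', hp1, ← hfac k]
        have hi : (b k)⁻¹ ^ (2 * s) * (-b k) ^ s = (-(b k)⁻¹) ^ s := by
          rw [pow_mul, ← mul_pow]
          congr 1
          have := hb0 k
          field_simp
        rw [pow_add]
        have := hb0 k
        have hi2 : (b k)⁻¹ ^ 2 * (1 - b k ^ 2) = (b k)⁻¹ ^ 2 - 1 := by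
          field_simp
        linear_combination D k * (∏ l ∈ univ.erase k, efn (b l) (b k)) *
          ((b k)⁻¹ ^ 2 * (1 - b k ^ 2) * hi + (-(b k)⁻¹) ^ s * hi2 +
            ((b k)⁻¹ ^ 2 - 1) * hpow k (b k)⁻¹)
      · have ht : (if t then (1 : ℂ) else -1) ^ 2 = 1 := by cases t <;> simp
        simp only [f, Sum.elim_inr, p, eval_sub, eval_mul, eval_prod, eval_X, eval_C,
          eval_one, eval_pow, ht, sub_self, zero_mul, sub_zero]
        cases t
        · simp only [Bool.false_eq_true, if_false]
          rw [sub_eq_zero]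
          exact prod_congr rfl fun m _ => by ring
        · simp only [if_true]
          have : ∏ m, (a m - 1) = ∏ m, -(1 - 1 * a m) := prod_congr rfl fun m _ => by ring
          rw [this, prod_neg, card_univ, Fintype.card_fin, pow_add, pow_mul]
          simp
    · simp only [Fintype.card_sum, Fintype.card_fin, Fintype.card_bool]
      refine lt_of_le_of_ne (by omega) fun h => ?_
      have h' : p.natDegree = 2 * s + 2 := by omega
      rw [← h', coeff_natDegree, leadingCoeff_eq_zero] at hcoeff
      rw [hcoeff, natDegree_zero] at h'
      omega
  have := congrArg (Polynomial.eval z) hpz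
  simp only [p, Q, eval_sub, eval_mul, eval_prod, eval_X, eval_C, eval_one, eval_pow,
    eval_finsetSum, eval_zero] at this
  linear_combination this

theorem prod_update_update {ι M : Type*} [Fintype ι] [DecidableEq ι] [CommMonoid M]
    (g : ℂ → ℂ → M) (a α : ι → ℂ) (j : ι) (x y : ℂ) (c : M)
    (h : g x y = c * g (a j) (α j)) :
    ∏ m, g (Function.update a j x m) (Function.update α j y m) = c * ∏ m, g (a m) (α m) := by
  rw [← mul_prod_erase univ _ (mem_univ j), ← mul_prod_erase univ (fun m => g (a m) (α m))
    (mem_univ j), Function.update_self, Function.update_self, h, mul_assoc]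
  congr 2
  refine prod_congr rfl fun m hm => ?_
  rw [Function.update_of_ne (ne_of_mem_erase hm), Function.update_of_ne (ne_of_mem_erase hm)]

/-- The parameter shift multiplies the weight by `e(z; a_j)`. -/
theorem PhiLat_update {q : ℝ} (hq0 : 0 < q) (hq1 : q < 1) {s : ℕ}
    (a α : Fin (2 * s + 2) → ℂ) (j : Fin (2 * s + 2)) (h0 : a j ≠ 0) {ξ : ℂ} (hξ : ξ ≠ 0)
    (ν : ℤ) (h1 : (q : ℂ) ^ ν * ξ * a j ≠ 1) :
    PhiLat q s (Function.update a j ((q : ℂ) * a j)) (Function.update α j (α j + 1)) ξ ν =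
      efn ((q : ℂ) ^ ν * ξ) (a j) * PhiLat q s a α ξ ν := by
  have hq : (q : ℂ) ≠ 0 := by exact_mod_cast hq0.ne'
  unfold PhiLat
  refine prod_update_update (fun x y => (q : ℂ) ^ ((ν : ℂ) / 2) * x ^ (-ν) *
    ξ ^ ((1 : ℂ) / 2 - y) * (qp q ((q : ℂ) * ((q : ℂ) ^ ν * ξ) / x) /
      qp q ((q : ℂ) ^ ν * ξ * x))) a α j _ _ _ ?_
  set z : ℂ := (q : ℂ) ^ ν * ξ with hz
  have hz0 : z ≠ 0 := mul_ne_zero (zpow_ne_zero _ hq) hξ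
  have e1 : ξ ^ ((1 : ℂ) / 2 - (α j + 1)) = ξ ^ ((1 : ℂ) / 2 - α j) * ξ⁻¹ := by
    rw [← sub_sub, cpow_sub _ _ hξ, cpow_one, div_eq_mul_inv]
  have e2 : (q : ℂ) * z / (q * a j) = z / a j := by field_simp
  have e3 : z * (q * a j) = q * (z * a j) := by ring
  have e4 : ((q : ℂ) * a j) ^ (-ν) = (a j) ^ (-ν) * (z⁻¹ * ξ) := by
    rw [mul_zpow, hz, mul_inv, zpow_neg]
    field_simp
  have h1' : 1 - z * a j ≠ 0 := sub_ne_zero.mpr h1.symm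
  have e5 : efn z (a j) = z⁻¹ * (1 - z / a j) * (1 - z * a j) := by
    unfold efn
    field_simp
    ring
  rw [e1, e2, e3, e4, e5, qp_eq_mul hq0 hq1 (z / a j), qp_eq_mul hq0 hq1 (z * a j),
    mul_div_assoc, ← mul_div_mul_left _ (qp q (q * (z * a j))) h1']
  field_simp

/-- The parameter shift multiplies `Θ` by `-a_j`. -/
theorem ThetaBC_update {q : ℝ} (hq0 : 0 < q) (hq1 : q < 1) {s : ℕ}
    (a α : Fin (2 * s + 2) → ℂ) (j : Fin (2 * s + 2)) (h0 : a j ≠ 0) {ξ : ℂ} (hξ : ξ ≠ 0) :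
    ThetaBC q s (Function.update a j ((q : ℂ) * a j)) (Function.update α j (α j + 1)) ξ =
      -a j * ThetaBC q s a α ξ := by
  unfold ThetaBC
  have hsum : ∑ m, Function.update α j (α j + 1) m = ∑ m, α m + 1 := by
    rw [sum_update_of_mem (mem_univ j), ← add_sum_erase univ α (mem_univ j),
      sdiff_singleton_eq_erase]
    ring
  have hth : th q (q * a j * ξ) = -(a j * ξ)⁻¹ * th q (a j * ξ) := by
    rw [mul_assoc, th_q_mul hq0 hq1 (mul_ne_zero h0 hξ)]
  have hprod := prod_update_update (fun x _ => th q (x * ξ)) a α j (q * a j) (α j + 1) _ hth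
  rw [hprod, hsum, ← sub_sub, cpow_sub _ _ hξ, cpow_one]
  rcases eq_or_ne (∏ m, th q (a m * ξ)) 0 with h | h
  · simp [h]
  · field_simp

/-- The `q`-difference equation of the weight along the lattice. -/
theorem PhiLat_add_one {q : ℝ} (hq0 : 0 < q) (hq1 : q < 1) {s : ℕ}
    (a α : Fin (2 * s + 2) → ℂ) (h0 : ∀ m, a m ≠ 0) (ξ : ℂ)
    (ν : ℤ) (h1 : ∀ m, (q : ℂ) ^ ν * ξ * a m ≠ 1) :
    PhiLat q s a α ξ (ν + 1) * ∏ m, (a m - q * ((q : ℂ) ^ ν * ξ)) =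
      (q : ℂ) ^ (s + 1) * (∏ m, (1 - (q : ℂ) ^ ν * ξ * a m)) * PhiLat q s a α ξ ν := by
  have hq : (q : ℂ) ≠ 0 := by exact_mod_cast hq0.ne'
  have hc : (q : ℂ) ^ (s + 1) = ∏ _m : Fin (2 * s + 2), (q : ℂ) ^ ((1 : ℂ) / 2) := by
    rw [prod_const, card_univ, Fintype.card_fin, show 2 * s + 2 = 2 * (s + 1) by ring, pow_mul,
      ← cpow_nat_mul]
    simp
  unfold PhiLat
  rw [hc, ← prod_mul_distrib, ← prod_mul_distrib, ← prod_mul_distrib]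
  refine prod_congr rfl fun m _ => ?_
  have e0 : (q : ℂ) ^ (ν + 1) * ξ = q * ((q : ℂ) ^ ν * ξ) := by
    rw [zpow_add_one₀ hq]
    ring
  have h1m := h1 m
  rw [e0]
  generalize (q : ℂ) ^ ν * ξ = z at *
  have h1' : 1 - z * a m ≠ 0 := sub_ne_zero.mpr h1m.symm
  have ham := h0 m
  have e1 : (q : ℂ) ^ (((ν + 1 : ℤ) : ℂ) / 2) =
      (q : ℂ) ^ ((ν : ℂ) / 2) * (q : ℂ) ^ ((1 : ℂ) / 2) := by
    rw [← cpow_add _ _ hq]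
    push_cast
    ring_nf
  have e2 : a m ^ (-(ν + 1)) = a m ^ (-ν) * (a m)⁻¹ := by
    rw [neg_add, zpow_add₀ ham, zpow_neg_one]
  have e3 : (q : ℂ) * (q * z) / a m = q * (q * z / a m) := by ring
  have e4 : (q : ℂ) * z * a m = q * (z * a m) := by ring
  rw [e1, e2, e3, e4, qp_eq_mul hq0 hq1 (q * z / a m), qp_eq_mul hq0 hq1 (z * a m),
    ← mul_div_mul_left _ (qp q (q * (z * a m))) h1']
  field_simp

theorem prod_efn_eq {ι : Type*} (t : Finset ι) (b : ι → ℂ) (hb : ∀ k, b k ≠ 0) {z : ℂ}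
    (hz : z ≠ 0) :
    ∏ k ∈ t, efn z (b k) = (z ^ #t)⁻¹ * ∏ k ∈ t, ((z - b k) * (z - (b k)⁻¹)) := by
  rw [← inv_pow, ← prod_const, ← prod_mul_distrib]
  exact prod_congr rfl fun k _ => efn_eq hz (hb k)

theorem prod_efn_mul_eq {s : ℕ} (b : Fin s → ℂ) (hb : ∀ k, b k ≠ 0) {z : ℂ} (hz : z ≠ 0) :
    (∏ k, efn z (b k)) * (z⁻¹ - z) =
      (z ^ (s + 1))⁻¹ * ((∏ k, ((z - b k) * (z - (b k)⁻¹))) * (1 - z ^ 2)) := by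
  rw [prod_efn_eq _ _ hb hz, card_univ, Fintype.card_fin]
  generalize ∏ k, ((z - b k) * (z - (b k)⁻¹)) = p
  field_simp
  ring

open Filter Topology Asymptotics in
theorem isBigO_of_tendsto_zero {β : Type*} {l : Filter β} {s : ℕ} (a : Fin (2 * s + 2) → ℂ)
    (b : Fin s → ℂ) (ha : ∀ m, a m ≠ 0) (hb : ∀ k, b k ≠ 0) {z : β → ℂ} (hz : ∀ x, z x ≠ 0)
    (hl : Tendsto z l (𝓝 0)) :
    (fun x => (∏ m, (a m - z x)) / z x ^ (s + 1)) =O[l]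
      fun x => (∏ k, efn (z x) (b k)) * ((z x)⁻¹ - z x) := by
  simp only [fun x => prod_efn_mul_eq b hb (hz x), div_eq_inv_mul]
  refine (isBigO_refl _ l).mul ?_
  have hc : ContinuousAt (fun w : ℂ => ((∏ k, ((w - b k) * (w - (b k)⁻¹))) * (1 - w ^ 2)) /
      ∏ m, (a m - w)) 0 := by
    refine ContinuousAt.div (by fun_prop) (by fun_prop) ?_
    simpa [prod_ne_zero_iff] using ha
  refine isBigO_of_div_tendsto_nhds_of_ne_zero (hc.tendsto.comp hl) ?_
  simp [prod_eq_zero_iff, ha, hb]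

open Filter Topology Asymptotics in
theorem isBigO_of_tendsto_inv_zero {β : Type*} {l : Filter β} {s : ℕ}
    (a : Fin (2 * s + 2) → ℂ) (b : Fin s → ℂ) (hb : ∀ k, b k ≠ 0) {z : β → ℂ}
    (hz : ∀ x, z x ≠ 0) (hl : Tendsto (fun x => (z x)⁻¹) l (𝓝 0)) :
    (fun x => (∏ m, (a m - z x)) / z x ^ (s + 1)) =O[l]
      fun x => (∏ k, efn (z x) (b k)) * ((z x)⁻¹ - z x) := by
  have hr : ∀ x, (∏ k, efn (z x) (b k)) * ((z x)⁻¹ - z x) = ((z x)⁻¹ ^ (s + 1))⁻¹ *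
      ((∏ k, (((z x)⁻¹ - b k) * ((z x)⁻¹ - (b k)⁻¹))) * ((z x)⁻¹ ^ 2 - 1)) := fun x => by
    have h := prod_efn_mul_eq b hb (inv_ne_zero (hz x))
    simp only [efn_inv_left, inv_inv] at h
    linear_combination -h
  have hL : ∀ x, (∏ m, (a m - z x)) / z x ^ (s + 1) =
      ((z x)⁻¹ ^ (s + 1))⁻¹ * ∏ m, (a m * (z x)⁻¹ - 1) := fun x => by
    have h1 : ∏ m, (a m - z x) = z x ^ (2 * s + 2) * ∏ m, (a m * (z x)⁻¹ - 1) := by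
      have : z x ^ (2 * s + 2) = ∏ _m : Fin (2 * s + 2), z x := by simp
      rw [this, ← prod_mul_distrib]
      refine prod_congr rfl fun m _ => ?_
      have := hz x
      field_simp
    rw [h1, inv_pow, inv_inv]
    generalize ∏ m, (a m * (z x)⁻¹ - 1) = p
    have := hz x
    field_simp
    ring
  simp only [hr, hL]
  refine (isBigO_refl _ l).mul ?_
  have hc : ContinuousAt (fun w : ℂ => ((∏ k, ((w - b k) * (w - (b k)⁻¹))) * (w ^ 2 - 1)) /
      ∏ m, (a m * w - 1)) 0 := by
    refine ContinuousAt.div (by fun_prop) (by fun_prop) ?_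
    simp
  refine isBigO_of_div_tendsto_nhds_of_ne_zero (hc.tendsto.comp hl) ?_
  simp [hb]

open Filter Topology Asymptotics in
theorem isBigO_cofinite_zpow {q : ℝ} (hq0 : 0 < q) (hq1 : q < 1) {s : ℕ}
    (a : Fin (2 * s + 2) → ℂ) (b : Fin s → ℂ) (ha : ∀ m, a m ≠ 0) (hb : ∀ k, b k ≠ 0)
    {ξ : ℂ} (hξ : ξ ≠ 0) :
    (fun ν : ℤ => (∏ m, (a m - (q : ℂ) ^ ν * ξ)) / ((q : ℂ) ^ ν * ξ) ^ (s + 1)) =O[cofinite]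
      fun ν : ℤ => (∏ k, efn ((q : ℂ) ^ ν * ξ) (b k)) *
        (((q : ℂ) ^ ν * ξ)⁻¹ - (q : ℂ) ^ ν * ξ) := by
  have hq : (q : ℂ) ≠ 0 := by exact_mod_cast hq0.ne'
  have hz : ∀ ν : ℤ, (q : ℂ) ^ ν * ξ ≠ 0 := fun ν => mul_ne_zero (zpow_ne_zero _ hq) hξ
  have hpow : Tendsto (fun ν : ℤ => (q : ℂ) ^ ν) atTop (𝓝 0) := by
    rw [← Nat.map_cast_int_atTop, tendsto_map'_iff]
    simpa [Function.comp_def] using tendsto_pow_atTop_nhds_zero_of_norm_lt_one (x := (q : ℂ))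
      (by simpa [abs_of_pos hq0] using hq1)
  rw [Int.cofinite_eq]
  refine IsBigO.sup (isBigO_of_tendsto_inv_zero a b hb hz ?_)
    (isBigO_of_tendsto_zero a b ha hb hz ?_)
  · have := (hpow.comp tendsto_neg_atBot_atTop).mul_const ξ⁻¹
    simpa [Function.comp_def, mul_comm] using this
  · simpa using hpow.mul_const ξ

/-- The total `q`-difference expanded in products of the `e(z; a_m)`. -/
theorem prod_div_sub_prod_div_eq {s : ℕ} (a : Fin (2 * s + 2) → ℂ)
    (κ : Fin s → Fin (2 * s + 2)) (h0 : ∀ m, a m ≠ 0) (hbal : ∏ m, a m ≠ 1)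
    (h2 : ∀ k, a (κ k) ^ 2 ≠ 1) (he : ∀ k l, k ≠ l → efn (a (κ k)) (a (κ l)) ≠ 0)
    {z : ℂ} (hz : z ≠ 0) :
    (∏ m, (1 - z * a m)) / z ^ (s + 1) - (∏ m, (a m - z)) / z ^ (s + 1) =
      (1 - ∏ m, a m) * (∏ k, efn z (a (κ k))) * (z⁻¹ - z) -
        (1 - ∏ m, a m) * (∑ k, (∏ m, (1 - a (κ k) * a m)) / ((-a (κ k)) ^ s *
          (1 - ∏ m, a m) * (1 - a (κ k) ^ 2) * ∏ l ∈ univ.erase k, efn (a (κ l)) (a (κ k))) *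
            (∏ l ∈ univ.erase k, efn z (a (κ l)))) * (z⁻¹ - z) := by
  have hA : 1 - ∏ m, a m ≠ 0 := sub_ne_zero.mpr hbal.symm
  set E : Fin s → ℂ := fun k => (∏ m, (1 - a (κ k) * a m)) / ((-a (κ k)) ^ s *
    (1 - ∏ m, a m) * (1 - a (κ k) ^ 2) * ∏ l ∈ univ.erase k, efn (a (κ l)) (a (κ k))) with hE
  have hk : ∀ k, (1 - ∏ m, a m) * (E k * ∏ l ∈ univ.erase k, efn z (a (κ l))) =
      (z ^ s)⁻¹ * (z * ((∏ m, (1 - a (κ k) * a m)) / ((-a (κ k)) ^ s * (1 - a (κ k) ^ 2) *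
        ∏ l ∈ univ.erase k, efn (a (κ l)) (a (κ k))) *
        ∏ l ∈ univ.erase k, ((z - a (κ l)) * (z - (a (κ l))⁻¹)))) := fun k => by
    have hs1 : s = (s - 1) + 1 := by have := k.isLt; omega
    have hp := prod_efn_eq (univ.erase k) (fun l => a (κ l)) (fun l => h0 _) hz
    have hc : #(univ.erase k) = s - 1 := by simp
    have hzs : (z ^ s)⁻¹ * z = (z ^ (s - 1))⁻¹ := by
      conv_lhs => rw [hs1, pow_succ]
      field_simp
    have hEk : (1 - ∏ m, a m) * E k = (∏ m, (1 - a (κ k) * a m)) / ((-a (κ k)) ^ s *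
        (1 - a (κ k) ^ 2) * ∏ l ∈ univ.erase k, efn (a (κ l)) (a (κ k))) := by
      rw [hE, ← mul_div_mul_left _ ((-a (κ k)) ^ s * (1 - a (κ k) ^ 2) *
        ∏ l ∈ univ.erase k, efn (a (κ l)) (a (κ k))) hA, ← mul_div_assoc]
      congr 1
      ring
    rw [← mul_assoc, hEk, hp, hc, ← hzs]
    ring
  have hsum : (1 - ∏ m, a m) * ∑ k, E k * (∏ l ∈ univ.erase k, efn z (a (κ l))) =
      (z ^ s)⁻¹ * (z * ∑ k, (∏ m, (1 - a (κ k) * a m)) / ((-a (κ k)) ^ s *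
        (1 - a (κ k) ^ 2) * ∏ l ∈ univ.erase k, efn (a (κ l)) (a (κ k))) *
        ∏ l ∈ univ.erase k, ((z - a (κ l)) * (z - (a (κ l))⁻¹))) := by
    simp only [mul_sum, hk]
  have hp := prod_efn_eq univ (fun l => a (κ l)) (fun l => h0 _) hz
  rw [card_univ, Fintype.card_fin] at hp
  have hint := prod_sub_prod_eq a κ h0 h2 he z
  rw [hsum, hp, ← sub_div, ← neg_sub (∏ m, (a m - z)), hint]
  generalize ∏ k, ((z - a (κ k)) * (z - (a (κ k))⁻¹)) = p
  generalize (∑ k, (∏ m, (1 - a (κ k) * a m)) / ((-a (κ k)) ^ s * (1 - a (κ k) ^ 2) *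
    ∏ l ∈ univ.erase k, efn (a (κ l)) (a (κ k))) *
      ∏ l ∈ univ.erase k, ((z - a (κ l)) * (z - (a (κ l))⁻¹))) = t
  generalize 1 - ∏ m, a m = A
  field_simp
  ring

theorem summable_PhiLat_mul {q : ℝ} (hq0 : 0 < q) (hq1 : q < 1) {s : ℕ}
    (a α : Fin (2 * s + 2) → ℂ) (κ : Fin s → Fin (2 * s + 2)) (h0 : ∀ m, a m ≠ 0)
    {ξ : ℂ} (hξ : ξ ≠ 0)
    (hP : Summable (jSummand q s a α (fun z => ∏ k, efn z (a (κ k))) ξ)) :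
    Summable fun ν : ℤ => PhiLat q s a α ξ ν *
      ((∏ m, (a m - (q : ℂ) ^ ν * ξ)) / ((q : ℂ) ^ ν * ξ) ^ (s + 1)) := by
  have hO := (Asymptotics.isBigO_refl (PhiLat q s a α ξ) Filter.cofinite).mul
    (isBigO_cofinite_zpow hq0 hq1 a (fun k => a (κ k)) h0 (fun k => h0 _) hξ)
  have hg : ∀ ν, jSummand q s a α (fun z => ∏ k, efn z (a (κ k))) ξ ν =
      PhiLat q s a α ξ ν * ((∏ k, efn ((q : ℂ) ^ ν * ξ) (a (κ k))) *
        (((q : ℂ) ^ ν * ξ)⁻¹ - (q : ℂ) ^ ν * ξ)) := fun ν => by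
    simp only [jSummand]
    ring
  simp only [← hg] at hO
  exact summable_of_isBigO hP.norm hO.norm_right

theorem tsum_add_one_sub_self {F : ℤ → ℂ} (hF : Summable F) :
    ∑' ν, (F (ν + 1) - F ν) = 0 := by
  have hshift : ∑' ν, F (ν + 1) = ∑' ν, F ν := (Equiv.addRight (1 : ℤ)).tsum_eq F
  have hFs : Summable fun ν => F (ν + 1) := (Equiv.addRight (1 : ℤ)).summable_iff.mpr hF
  rw [hFs.tsum_sub hF, hshift, sub_self]

/-- The linear relation among Jackson integrals coming from a total `q`-difference. -/
theorem tsum_jSummand_relation {q : ℝ} (hq0 : 0 < q) (hq1 : q < 1) {s : ℕ}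
    (a α : Fin (2 * s + 2) → ℂ) (κ : Fin s → Fin (2 * s + 2)) (h0 : ∀ m, a m ≠ 0)
    (hbal : ∏ m, a m ≠ 1) (h2 : ∀ k, a (κ k) ^ 2 ≠ 1)
    (he : ∀ k l, k ≠ l → efn (a (κ k)) (a (κ l)) ≠ 0) {ξ : ℂ} (hξ : ξ ≠ 0)
    (h1 : ∀ (ν : ℤ) m, (q : ℂ) ^ ν * ξ * a m ≠ 1)
    (hP : Summable (jSummand q s a α (fun z => ∏ k, efn z (a (κ k))) ξ))
    (hPk : ∀ k, Summable (jSummand q s a α (fun z => ∏ l ∈ univ.erase k, efn z (a (κ l))) ξ)) :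
    ∑' ν, jSummand q s a α (fun z => ∏ k, efn z (a (κ k))) ξ ν =
      ∑ k, (∏ m, (1 - a (κ k) * a m)) / ((-a (κ k)) ^ s * (1 - ∏ m, a m) *
        (1 - a (κ k) ^ 2) * ∏ l ∈ univ.erase k, efn (a (κ l)) (a (κ k))) *
          ∑' ν, jSummand q s a α (fun z => ∏ l ∈ univ.erase k, efn z (a (κ l))) ξ ν := by
  have hq : (q : ℂ) ≠ 0 := by exact_mod_cast hq0.ne'
  have hA : 1 - ∏ m, a m ≠ 0 := sub_ne_zero.mpr hbal.symm
  let F : ℤ → ℂ := fun ν => PhiLat q s a α ξ ν *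
    ((∏ m, (a m - (q : ℂ) ^ ν * ξ)) / ((q : ℂ) ^ ν * ξ) ^ (s + 1))
  have hF : Summable F :=
    summable_PhiLat_mul hq0 hq1 a α κ h0 hξ hP
  have hFν : ∀ ν, F ν = PhiLat q s a α ξ ν *
      ((∏ m, (a m - (q : ℂ) ^ ν * ξ)) / ((q : ℂ) ^ ν * ξ) ^ (s + 1)) := fun _ => rfl
  clear_value F
  have hzero := tsum_add_one_sub_self hF
  let E : Fin s → ℂ := fun k => (∏ m, (1 - a (κ k) * a m)) / ((-a (κ k)) ^ s *
    (1 - ∏ m, a m) * (1 - a (κ k) ^ 2) * ∏ l ∈ univ.erase k, efn (a (κ l)) (a (κ k)))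
  have hN : ∀ z : ℂ, z ≠ 0 →
      (∏ m, (1 - z * a m)) / z ^ (s + 1) - (∏ m, (a m - z)) / z ^ (s + 1) =
        (1 - ∏ m, a m) * (∏ k, efn z (a (κ k))) * (z⁻¹ - z) - (1 - ∏ m, a m) *
          (∑ k, E k * (∏ l ∈ univ.erase k, efn z (a (κ l)))) * (z⁻¹ - z) :=
    fun z hz => prod_div_sub_prod_div_eq a κ h0 hbal h2 he hz
  change _ = ∑ k, E k * _
  clear_value E
  have hpt : ∀ ν, F (ν + 1) - F ν = (1 - ∏ m, a m) *
      (jSummand q s a α (fun z => ∏ k, efn z (a (κ k))) ξ ν -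
        ∑ k, E k * jSummand q s a α (fun z => ∏ l ∈ univ.erase k, efn z (a (κ l))) ξ ν) := by
    intro ν
    have hs := PhiLat_add_one hq0 hq1 a α h0 ξ ν (h1 ν)
    have e0 : (q : ℂ) ^ (ν + 1) * ξ = q * ((q : ℂ) ^ ν * ξ) := by
      rw [zpow_add_one₀ hq]
      ring
    have hz : (q : ℂ) ^ ν * ξ ≠ 0 := mul_ne_zero (zpow_ne_zero _ hq) hξ
    simp only [hFν, e0, jSummand]
    generalize (q : ℂ) ^ ν * ξ = z at hs hz ⊢
    generalize PhiLat q s a α ξ ν = f at hs ⊢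
    generalize PhiLat q s a α ξ (ν + 1) = g at hs ⊢
    have hF1 : g * ((∏ m, (a m - q * z)) / (q * z) ^ (s + 1)) =
        f * ((∏ m, (1 - z * a m)) / z ^ (s + 1)) := by
      rw [← mul_div_assoc, hs, mul_pow, ← mul_div_assoc, mul_assoc,
        mul_div_mul_left _ _ (pow_ne_zero _ hq), mul_comm f]
    have hsum' : ∑ k, E k * ((∏ l ∈ univ.erase k, efn z (a (κ l))) * f *
        (z⁻¹ - z)) = (∑ k, E k * (∏ l ∈ univ.erase k, efn z (a (κ l)))) *
          (f * (z⁻¹ - z)) := by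
      rw [sum_mul]
      exact sum_congr rfl fun k _ => by ring
    rw [hF1, hsum']
    linear_combination f * hN z hz
  have hsumm : Summable fun ν =>
      ∑ k, E k * jSummand q s a α (fun z => ∏ l ∈ univ.erase k, efn z (a (κ l))) ξ ν :=
    summable_sum fun k _ => (hPk k).mul_left _
  have hlin : ∑' ν, ∑ k, E k * jSummand q s a α
      (fun z => ∏ l ∈ univ.erase k, efn z (a (κ l))) ξ ν =
        ∑ k, E k * ∑' ν, jSummand q s a α
          (fun z => ∏ l ∈ univ.erase k, efn z (a (κ l))) ξ ν := by
    rw [Summable.tsum_finsetSum fun k _ => (hPk k).mul_left (E k)]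
    exact sum_congr rfl fun k _ => tsum_mul_left
  rw [tsum_congr hpt, tsum_mul_left, hP.tsum_sub hsumm, hlin] at hzero
  exact sub_eq_zero.mp ((mul_eq_zero.mp hzero).resolve_left hA)

theorem prod_univ_erase_zero {M : Type*} [CommMonoid M] {n : ℕ} (g : Fin (n + 1) → M) :
    ∏ l ∈ univ.erase 0, g l = ∏ l : Fin n, g l.succ := by
  rw [Fin.univ_succ, erase_cons, prod_map]
  rfl

theorem prod_univ_erase_succ {M : Type*} [CommMonoid M] {n : ℕ} (g : Fin (n + 1) → M)
    (k : Fin n) :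
    ∏ l ∈ univ.erase k.succ, g l = g 0 * ∏ l ∈ univ.erase k, g l.succ := by
  have h : univ.erase k.succ = insert 0 ((univ.erase k).map (Fin.succEmb n)) := by
    ext x
    refine Fin.cases ?_ (fun y => ?_) x
    · simp [(Fin.succ_ne_zero k).symm]
    · simp [Fin.succ_ne_zero]
  rw [h, prod_insert (by simp [Fin.succ_ne_zero]), prod_map]
  rfl

theorem jSummand_update {q : ℝ} (hq0 : 0 < q) (hq1 : q < 1) {s : ℕ}
    (a α : Fin (2 * s + 2) → ℂ) (j : Fin (2 * s + 2)) (h0 : a j ≠ 0) {ξ : ℂ} (hξ : ξ ≠ 0)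
    (φ : ℂ → ℂ) (ν : ℤ) (h1 : (q : ℂ) ^ ν * ξ * a j ≠ 1) :
    jSummand q s (Function.update a j ((q : ℂ) * a j)) (Function.update α j (α j + 1)) φ ξ ν =
      jSummand q s a α (fun z => efn z (a j) * φ z) ξ ν := by
  unfold jSummand
  rw [PhiLat_update hq0 hq1 a α j h0 hξ ν h1]
  ring

section Entries

variable {n : ℕ} (a : Fin (2 * (n + 1) + 2) → ℂ) (i : Fin n → Fin (2 * (n + 1) + 2))
  (j : Fin (2 * (n + 1) + 2))

theorem vBasis_zero : vBasis (n + 1) a i 0 = fun z => ∏ l, efn z (a (i l)) := rfl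

theorem vBasis_succ (k : Fin n) :
    vBasis (n + 1) a i k.succ = fun z => ∏ l ∈ univ.erase k, efn z (a (i l)) := rfl

theorem cEnt_zero : cEnt (n + 1) a i j 0 = (∏ m, (1 - a j * a m)) /
    ((-a j) ^ (n + 1) * (1 - ∏ m, a m) * (1 - a j ^ 2) * ∏ l, efn (a (i l)) (a j)) := rfl

theorem cEnt_succ (k : Fin n) : cEnt (n + 1) a i j k.succ = efn (a (i k)) (a j) := rfl

theorem sum_mul_Umat_mul_Lmat_zero (J : Fin (n + 1) → ℂ) :
    ∑ r, J r * (Umat (n + 1) a i j * Lmat (n + 1) a i j) r 0 =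
      cEnt (n + 1) a i j 0 * J 0 + ∑ k : Fin n, dEnt (n + 1) a i j k.succ *
        (J 0 + cEnt (n + 1) a i j k.succ * J k.succ) := by
  simp only [Matrix.mul_apply, Umat, Lmat, Matrix.of_apply, Fin.sum_univ_succ]
  simp [Fin.succ_ne_zero, (Fin.succ_ne_zero _).symm, mul_add, sum_add_distrib, mul_sum]
  rw [add_assoc]
  congr 1
  · ring
  · congr 1 <;> exact sum_congr rfl fun k _ => by ring

theorem sum_mul_Umat_mul_Lmat_succ (J : Fin (n + 1) → ℂ) (k : Fin n) :
    ∑ r, J r * (Umat (n + 1) a i j * Lmat (n + 1) a i j) r k.succ =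
      J 0 + cEnt (n + 1) a i j k.succ * J k.succ := by
  simp only [Matrix.mul_apply, Umat, Lmat, Matrix.of_apply, Fin.sum_univ_succ]
  simp [Fin.succ_ne_zero, (Fin.succ_ne_zero _).symm, mul_comm]

theorem det_Umat_mul_Lmat :
    (Umat (n + 1) a i j * Lmat (n + 1) a i j).det =
      cEnt (n + 1) a i j 0 * ∏ k, efn (a (i k)) (a j) := by
  have hU : (Umat (n + 1) a i j).det = ∏ k, Umat (n + 1) a i j k k := by
    refine Matrix.det_of_isUpperTriangular fun r c hrc => ?_
    have hrc' : c < r := hrc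
    have h0 : r ≠ 0 := ((Fin.zero_le c).trans_lt hrc').ne'
    simp [Umat, hrc'.ne', h0]
  have hL : (Lmat (n + 1) a i j).det = ∏ k, Lmat (n + 1) a i j k k := by
    refine Matrix.det_of_isLowerTriangular _ fun r c hrc => ?_
    have hrc' : r < c := hrc
    have h0 : c ≠ 0 := ((Fin.zero_le r).trans_lt hrc').ne'
    simp [Lmat, hrc'.ne, h0]
  rw [Matrix.det_mul, hU, hL, Fin.prod_univ_succ]
  simp [Umat, Lmat, cEnt_succ]

end Entries

theorem neg_efn_div {x y : ℂ} (hx : x ≠ 0) (hy : y ≠ 0) :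
    -efn x y / y = (1 - x * y⁻¹) * (1 - x⁻¹ * y⁻¹) := by
  unfold efn
  field_simp
  ring

theorem prod_one_sub_inv_mul_inv {n : ℕ} (a : Fin n → ℂ) (h0 : ∀ m, a m ≠ 0) {x : ℂ}
    (hx : x ≠ 0) :
    ∏ m, (1 - x⁻¹ * (a m)⁻¹) = (-x⁻¹) ^ n * (∏ m, a m)⁻¹ * ∏ m, (1 - x * a m) := by
  have : (-x⁻¹) ^ n = ∏ _m : Fin n, -x⁻¹ := by simp
  rw [this, ← prod_inv_distrib, ← prod_mul_distrib, ← prod_mul_distrib]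
  refine prod_congr rfl fun m _ => ?_
  have := h0 m
  field_simp
  ring

theorem neg_div_eq_div_inv (n : ℕ) {x A : ℂ} (E N : ℂ) (hx : x ≠ 0) (hA : A ≠ 0)
    (hA1 : 1 - A ≠ 0) (hx1 : 1 - x ^ 2 ≠ 0) (hE : E ≠ 0) :
    -(N / ((-x) ^ (n + 1) * (1 - A) * (1 - x ^ 2) * E)) / x =
      (-x⁻¹) ^ (2 * (n + 1) + 2) * A⁻¹ * N /
        ((1 - A⁻¹) * (1 - (x ^ 2)⁻¹) * ((-x⁻¹) ^ n * E)) := by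
  obtain ⟨u, rfl⟩ : ∃ u, x = -u := ⟨-x, by simp⟩
  have hu : u ≠ 0 := neg_ne_zero.mp hx
  rw [neg_sq] at hx1
  have e1 : 1 - A⁻¹ = -((1 - A) / A) := by
    field_simp
    ring
  have e2 : 1 - (u ^ 2)⁻¹ = -((1 - u ^ 2) / u ^ 2) := by
    field_simp
    ring
  have e3 : -(-u)⁻¹ = u⁻¹ := by rw [inv_neg, neg_neg]
  rw [neg_neg, neg_sq, e1, e2, e3]
  simp only [inv_pow]
  field_simp
  ring

/-- The first order `q`-difference system for the regularized
`BC₁`-type Jackson integrals: `T_{a_j}(⟨⟨v₀,ξ⟩⟩,…) = (⟨⟨v₀,ξ⟩⟩,…) ⋅ B̄` with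
`B̄ = (-1/a_j) U L`, together with the product formulas for `-c₀/a_j`, `-c_k/a_j`
and `det B̄`. -/
theorem stmt6 (q : ℝ) (hq0 : 0 < q) (hq1 : q < 1) (s : ℕ) (hs : 1 ≤ s)
    (a α : Fin (2 * s + 2) → ℂ) (ha : ∀ m, a m = (q : ℂ) ^ α m)
    (hbal : ∏ m, a m ≠ 1)
    (i : Fin (s - 1) → Fin (2 * s + 2)) (hi : Function.Injective i)
    (j : Fin (2 * s + 2)) (hj : j ∉ Set.range i)
    (hj2 : a j ^ 2 ≠ 1) (hik2 : ∀ k, a (i k) ^ 2 ≠ 1)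
    (he1 : ∀ k l, k ≠ l → efn (a (i k)) (a (i l)) ≠ 0)
    (he2 : ∀ k, efn (a j) (a (i k)) ≠ 0)
    (ξ : ℂ) (hξ : ξ ≠ 0)
    (hΘ : ThetaBC q s a α ξ ≠ 0)
    (hΘ' : ThetaBC q s (Function.update a j ((q : ℂ) * a j))
      (Function.update α j (α j + 1)) ξ ≠ 0)
    (hconv : ∀ k : Fin s, Summable fun ν : ℤ =>
      ‖jSummand q s a α (vBasis s a i k) ξ ν‖)
    (hconv' : ∀ k : Fin s, Summable fun ν : ℤ =>
      ‖jSummand q s (Function.update a j ((q : ℂ) * a j))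
        (Function.update α j (α j + 1)) (vBasis s a i k) ξ ν‖) :
    (∀ k : Fin s,
      jInt q s (Function.update a j ((q : ℂ) * a j)) (Function.update α j (α j + 1))
            (vBasis s a i k) ξ /
          ThetaBC q s (Function.update a j ((q : ℂ) * a j))
            (Function.update α j (α j + 1)) ξ =
        ∑ r : Fin s, (jInt q s a α (vBasis s a i r) ξ / ThetaBC q s a α ξ) *
          ((-(a j)⁻¹) • (Umat s a i j * Lmat s a i j)) r k) ∧
    -((∏ m, (1 - a j * a m)) /
        ((-a j) ^ s * (1 - ∏ m, a m) * (1 - a j ^ 2) * ∏ l, efn (a (i l)) (a j))) / a j =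
      (∏ m, (1 - (a j)⁻¹ * (a m)⁻¹)) /
        ((1 - ∏ m, (a m)⁻¹) * (1 - (a j ^ 2)⁻¹) *
          ∏ l, ((1 - a (i l) * (a j)⁻¹) * (1 - (a (i l))⁻¹ * (a j)⁻¹))) ∧
    (∀ k : Fin (s - 1), -efn (a (i k)) (a j) / a j =
      (1 - a (i k) * (a j)⁻¹) * (1 - (a (i k))⁻¹ * (a j)⁻¹)) ∧
    ((-(a j)⁻¹) • (Umat s a i j * Lmat s a i j)).det =
      (∏ m, (1 - (a j)⁻¹ * (a m)⁻¹)) / ((1 - (a j ^ 2)⁻¹) * (1 - ∏ m, (a m)⁻¹)) := by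
  have hq : (q : ℂ) ≠ 0 := by exact_mod_cast hq0.ne'
  have h0 : ∀ m, a m ≠ 0 := fun m => by
    rw [ha m]
    exact cpow_ne_zero_iff.mpr (Or.inl hq)
  obtain ⟨n, rfl⟩ : ∃ n, s = n + 1 := ⟨s - 1, by omega⟩
  change Fin n → _ at i
  have hA : 1 - ∏ m, a m ≠ 0 := sub_ne_zero.mpr hbal.symm
  have hj2' : 1 - a j ^ 2 ≠ 0 := sub_ne_zero.mpr hj2.symm
  have hE : ∏ l, efn (a (i l)) (a j) ≠ 0 := prod_ne_zero_iff.mpr fun l _ => by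
    rw [efn_swap]
    exact neg_ne_zero.mpr (he2 l)
  have h1 : ∀ (ν : ℤ) m, (q : ℂ) ^ ν * ξ * a m ≠ 1 := fun ν m => by
    have hth : th q (a m * ξ) ≠ 0 := fun h =>
      hΘ (by rw [ThetaBC, prod_eq_zero (mem_univ m) h, div_zero])
    have := zpow_mul_ne_one_of_th_ne_zero hq0 hth ν
    rwa [mul_assoc, mul_comm ξ]
  have hN := prod_one_sub_inv_mul_inv a h0 (h0 j)
  have hPe : ∏ l, ((1 - a (i l) * (a j)⁻¹) * (1 - (a (i l))⁻¹ * (a j)⁻¹)) =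
      (-(a j)⁻¹) ^ n * ∏ l, efn (a (i l)) (a j) := by
    have : (-(a j)⁻¹) ^ n = ∏ _l : Fin n, -(a j)⁻¹ := by simp
    rw [this, ← prod_mul_distrib]
    refine prod_congr rfl fun l _ => ?_
    rw [← neg_efn_div (h0 _) (h0 _)]
    ring
  refine ⟨?_, ?_, fun k => neg_efn_div (h0 _) (h0 _), ?_⟩
  · have hup : ∀ φ : ℂ → ℂ, jSummand q (n + 1) (Function.update a j ((q : ℂ) * a j))
        (Function.update α j (α j + 1)) φ ξ =
          jSummand q (n + 1) a α (fun z => efn z (a j) * φ z) ξ := fun φ =>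
      funext fun ν => jSummand_update hq0 hq1 a α j (h0 j) hξ φ ν (h1 ν j)
    have hS := fun k => (hconv k).of_norm
    have hS' := fun k => (hconv' k).of_norm
    simp only [hup] at hS'
    have hsucc : ∀ k : Fin n,
        ∑' ν, jSummand q (n + 1) a α
            (fun z => efn z (a j) * vBasis (n + 1) a i k.succ z) ξ ν =
          ∑' ν, jSummand q (n + 1) a α (vBasis (n + 1) a i 0) ξ ν +
            cEnt (n + 1) a i j k.succ *
              ∑' ν, jSummand q (n + 1) a α (vBasis (n + 1) a i k.succ) ξ ν := fun k => by
      rw [← tsum_mul_left, ← (hS 0).tsum_add ((hS k.succ).mul_left _)]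
      refine tsum_congr fun ν => ?_
      simp only [jSummand, vBasis_zero, vBasis_succ, cEnt_succ]
      rw [← mul_prod_erase univ _ (mem_univ k)]
      unfold efn
      ring
    have hzero : ∑' ν, jSummand q (n + 1) a α
          (fun z => efn z (a j) * vBasis (n + 1) a i 0 z) ξ ν =
        cEnt (n + 1) a i j 0 * ∑' ν, jSummand q (n + 1) a α (vBasis (n + 1) a i 0) ξ ν +
          ∑ k : Fin n, dEnt (n + 1) a i j k.succ * ∑' ν, jSummand q (n + 1) a α
            (fun z => efn z (a j) * vBasis (n + 1) a i k.succ z) ξ ν := by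
      let κ : Fin (n + 1) → Fin (2 * (n + 1) + 2) := Fin.cons j i
      have hκ0 : κ 0 = j := rfl
      have hκs : ∀ k : Fin n, κ k.succ = i k := fun _ => rfl
      have hrel := tsum_jSummand_relation hq0 hq1 a α κ h0 hbal
        (Fin.cases hj2 hik2)
        (Fin.cases (Fin.cases (fun h => absurd rfl h) fun l _ => he2 l)
          fun k => Fin.cases
            (fun _ => by
              rw [efn_swap]
              exact neg_ne_zero.mpr (he2 k))
            fun l hkl => he1 k l fun h => hkl (congrArg Fin.succ h)) hξ h1
        (by
          simp only [Fin.prod_univ_succ, hκ0, hκs]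
          exact hS' 0)
        (Fin.cases
          (by
            simp only [prod_univ_erase_zero, hκs]
            exact hS 0)
          fun k => by
            simp only [prod_univ_erase_succ, hκ0, hκs]
            exact hS' k.succ)
      rw [Fin.sum_univ_succ] at hrel
      simp only [prod_univ_erase_zero, prod_univ_erase_succ, hκ0, hκs, Fin.prod_univ_succ
        (fun k => efn _ (a (κ k))), ← mul_assoc] at hrel
      exact hrel
    have hmain : ∀ k, jInt q (n + 1) (Function.update a j ((q : ℂ) * a j))
        (Function.update α j (α j + 1)) (vBasis (n + 1) a i k) ξ =
          ∑ r, jInt q (n + 1) a α (vBasis (n + 1) a i r) ξ *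
            (Umat (n + 1) a i j * Lmat (n + 1) a i j) r k := by
      refine Fin.cases ?_ fun k => ?_
      · rw [sum_mul_Umat_mul_Lmat_zero]
        simp only [jInt, hup]
        rw [hzero, mul_add, mul_sum]
        simp only [hsucc]
        congr 1
        · ring
        · exact sum_congr rfl fun k _ => by ring
      · rw [sum_mul_Umat_mul_Lmat_succ]
        simp only [jInt, hup]
        rw [hsucc]
        ring
    intro k
    rw [hmain k, ThetaBC_update hq0 hq1 a α j (h0 j) hξ, sum_div]
    refine sum_congr rfl fun r _ => ?_
    rw [Matrix.smul_apply, smul_eq_mul]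
    have := h0 j
    field_simp
  · rw [hN, prod_inv_distrib]
    refine (neg_div_eq_div_inv n _ _ (h0 j) (prod_ne_zero_iff.mpr fun m _ => h0 m) hA hj2'
      hE).trans ?_
    rw [← hPe]
    rfl
  · rw [Matrix.det_smul, det_Umat_mul_Lmat, Fintype.card_fin, cEnt_zero, hN, prod_inv_distrib]
    have h := neg_div_eq_div_inv n _ (∏ m, (1 - a j * a m)) (h0 j)
      (prod_ne_zero_iff.mpr fun m _ => h0 m) hA hj2' hE
    have hpn : (-(a j)⁻¹) ^ n ≠ 0 := pow_ne_zero _ (neg_ne_zero.mpr (inv_ne_zero (h0 j)))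
    refine Eq.trans ?_ ((congrArg (· * ((-(a j)⁻¹) ^ n * ∏ l, efn (a (i l)) (a j))) h).trans ?_)
    · rw [pow_succ (-(a j)⁻¹)]
      ring
    · rw [div_mul_eq_mul_div, mul_div_mul_right _ _ (mul_ne_zero hpn hE),
        mul_comm (1 - (∏ m, a m)⁻¹)]
end
end

section
/- Let n ≥ 1 and s = n, with nonzero generic parameters a_1, …, a_{2n+2} (all sums converge absolutely, Θ_G(x) ≠ 0). Then for every x = (x_1, …, x_n) ∈ (ℂ*)^n, det( ⟨⟨χ_{(n−i)}, x_j⟩⟩ )_{1 ≤ i, j ≤ n} = ⟨⟨1, x⟩⟩_G · ∏_{1 ≤ j < k ≤ n} θ(x_j/x_k) θ(x_j x_k) / x_j, where the (i,j) entry is the regularized BC_1-type Jackson integral of the character χ_{(n−i)} at the point x_j. -/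
open Complex Finset

noncomputable section

/-- The `C_n` Weyl denominator
`Δ_{C_n}(z) = ∏_i (1-z_i²)/z_i ∏_{j<k} (1-z_j/z_k)(1-z_j z_k)/z_j`. -/
def DeltaC (n : ℕ) (z : Fin n → ℂ) : ℂ :=
  (∏ i, (1 - z i ^ 2) / z i) *
    ∏ j, ∏ k ∈ Ioi j, ((1 - z j / z k) * (1 - z j * z k) / z j)

/-- The value `Φ_G(q^ν x)` of Gustafson's weight along the `q`-lattice through `x`,
with `(q^(ν i) x_i)^(1/2 - α m)` interpreted as
`q^(ν i/2) * (a m)^(-ν i) * (x i)^(1/2 - α m)` for the fixed (principal) branch. -/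
def PhiGLat (q : ℝ) (n : ℕ) (a α : Fin (2 * n + 2) → ℂ) (x : Fin n → ℂ)
    (ν : Fin n → ℤ) : ℂ :=
  ∏ i, ∏ m, ((q : ℂ) ^ ((ν i : ℂ) / 2) * a m ^ (-ν i) * x i ^ ((1 : ℂ) / 2 - α m) *
    (qp q ((q : ℂ) * (a m)⁻¹ * ((q : ℂ) ^ ν i * x i)) /
      qp q (a m * ((q : ℂ) ^ ν i * x i))))

/-- The `ν`-th summand `Φ_G(q^ν x) Δ_{C_n}(q^ν x)` of Gustafson's sum `⟨1,x⟩_G`. -/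
def gSummand (q : ℝ) (n : ℕ) (a α : Fin (2 * n + 2) → ℂ) (x : Fin n → ℂ)
    (ν : Fin n → ℤ) : ℂ :=
  PhiGLat q n a α x ν * DeltaC n fun i => (q : ℂ) ^ ν i * x i

/-- Gustafson's `C_n`-type Jackson integral
`⟨1,x⟩_G = (1-q)^n ∑_{ν ∈ ℤⁿ} Φ_G(q^ν x) Δ_{C_n}(q^ν x)`. -/
def gInt (q : ℝ) (n : ℕ) (a α : Fin (2 * n + 2) → ℂ) (x : Fin n → ℂ) : ℂ :=
  (1 - (q : ℂ)) ^ n * ∑' ν : Fin n → ℤ, gSummand q n a α x ν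

/-- `Θ_G(x) = ∏_i x_i^(i-α₁-⋯-α_{2n+2}) θ(x_i²)/∏_m θ(a_m x_i)
⋅ ∏_{j<k} θ(x_j/x_k) θ(x_j x_k)`. -/
def ThetaG (q : ℝ) (n : ℕ) (a α : Fin (2 * n + 2) → ℂ) (x : Fin n → ℂ) : ℂ :=
  (∏ i, (x i ^ (((i : ℕ) + 1 : ℂ) - ∑ m, α m) * th q (x i ^ 2) /
      ∏ m, th q (a m * x i))) *
    ∏ j, ∏ k ∈ Ioi j, (th q (x j / x k) * th q (x j * x k))

/-- The irreducible `C₁`-character `χ_(i)(z) = (z^(i+1) - z^(-i-1))/(z - z⁻¹)`. -/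
def chiC (i : ℕ) (z : ℂ) : ℂ := (z ^ (i + 1) - z⁻¹ ^ (i + 1)) / (z - z⁻¹)

/-- A finite product of absolutely convergent series is the sum over all multi-indices. -/
theorem hasSum_prod_pi_of_summable_norm {ι R : Type*} [NormedCommRing R] [CompleteSpace R]
    {n : ℕ} {f : Fin n → ι → R} (hf : ∀ j, Summable fun ν => ‖f j ν‖) :
    (Summable fun ν : Fin n → ι => ‖∏ j, f j (ν j)‖) ∧
      HasSum (fun ν : Fin n → ι => ∏ j, f j (ν j)) (∏ j, ∑' ν, f j ν) := by
  induction n with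
  | zero =>
    refine ⟨Summable.of_finite, ?_⟩
    simp
  | succ n ih =>
    obtain ⟨hs, ht⟩ := ih fun j : Fin n => hf j.succ
    have hcons : ∀ p : ι × (Fin n → ι),
        ∏ j, f j (Fin.consEquiv (fun _ => ι) p j) = f 0 p.1 * ∏ j : Fin n, f j.succ (p.2 j) := by
      intro p
      simp [Fin.prod_univ_succ, Fin.consEquiv]
    constructor
    · rw [← (Fin.consEquiv fun _ : Fin (n + 1) => ι).summable_iff]
      simpa only [Function.comp_def, hcons] using (hf 0).mul_norm hs
    · rw [← (Fin.consEquiv fun _ : Fin (n + 1) => ι).hasSum_iff]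
      simp only [Function.comp_def, hcons]
      rw [Fin.prod_univ_succ]
      rw [← ht.tsum_eq, tsum_mul_tsum_of_summable_norm (hf 0) hs]
      exact (summable_mul_of_summable_norm (hf 0) hs).hasSum

/-- The determinant of a matrix of absolutely convergent series, expanded by columns. -/
theorem det_tsum_eq_tsum_det {ι R : Type*} [NormedCommRing R] [CompleteSpace R]
    {n : ℕ} {f : Fin n → Fin n → ι → R} (hf : ∀ i j, Summable fun ν => ‖f i j ν‖) :
    (Matrix.of fun i j => ∑' ν, f i j ν).det =
      ∑' ν : Fin n → ι, (Matrix.of fun i j => f i j (ν j)).det := by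
  simp only [Matrix.det_apply', Matrix.of_apply]
  have h : ∀ σ : Equiv.Perm (Fin n), HasSum
      (fun ν : Fin n → ι => ((Equiv.Perm.sign σ : ℤ) : R) * ∏ j, f (σ j) j (ν j))
      (((Equiv.Perm.sign σ : ℤ) : R) * ∏ j, ∑' ν, f (σ j) j ν) := fun σ =>
    (hasSum_prod_pi_of_summable_norm fun j => hf (σ j) j).2.mul_left _
  exact (hasSum_sum fun σ _ => h σ).tsum_eq.symm

theorem monic_natDegree_chebyshev_S (R : Type*) [CommRing R] [Nontrivial R] : ∀ k : ℕ,
    (Polynomial.Chebyshev.S R k).Monic ∧ (Polynomial.Chebyshev.S R k).natDegree = k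
  | 0 => by simp
  | 1 => by simp [Polynomial.monic_X]
  | k + 2 => by
    obtain ⟨-, hd⟩ := monic_natDegree_chebyshev_S R k
    obtain ⟨hm, hd'⟩ := monic_natDegree_chebyshev_S R (k + 1)
    push_cast at hm hd' ⊢
    rw [Polynomial.Chebyshev.S_add_two]
    have hXm := Polynomial.monic_X.mul hm
    have hXd : (Polynomial.X * Polynomial.Chebyshev.S R ((k : ℤ) + 1)).natDegree = k + 2 := by
      rw [Polynomial.monic_X.natDegree_mul hm, hd', Polynomial.natDegree_X]
      ring
    have hlt : (Polynomial.Chebyshev.S R (k : ℤ)).natDegree <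
        (Polynomial.X * Polynomial.Chebyshev.S R ((k : ℤ) + 1)).natDegree := by
      rw [hd, hXd]
      omega
    exact ⟨hXm.sub_of_left (Polynomial.degree_lt_degree hlt),
      (Polynomial.natDegree_sub_eq_left_of_natDegree_lt hlt).trans hXd⟩

theorem eval_chebyshev_S_mul_sub_inv {z : ℂ} (hz : z ≠ 0) : ∀ k : ℕ,
    (Polynomial.Chebyshev.S ℂ k).eval (z + z⁻¹) * (z - z⁻¹) = z ^ (k + 1) - z⁻¹ ^ (k + 1)
  | 0 => by simp
  | 1 => by simp; ring
  | k + 2 => by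
    have h := eval_chebyshev_S_mul_sub_inv hz k
    have h' := eval_chebyshev_S_mul_sub_inv hz (k + 1)
    push_cast at h' ⊢
    rw [Polynomial.Chebyshev.S_add_two, Polynomial.eval_sub, Polynomial.eval_mul,
      Polynomial.eval_X, sub_mul, mul_assoc, h, h']
    have hzz : z * z⁻¹ = 1 := mul_inv_cancel₀ hz
    linear_combination (z ^ (k + 1) - z⁻¹ ^ (k + 1)) * hzz

theorem chiC_mul_inv_sub {z : ℂ} (hz : z ≠ 0) (k : ℕ) :
    chiC k z * (z⁻¹ - z) = (Polynomial.Chebyshev.S ℂ k).eval (z + z⁻¹) * (z⁻¹ - z) := by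
  have h := eval_chebyshev_S_mul_sub_inv hz k
  unfold chiC
  rw [← h]
  by_cases h0 : z - z⁻¹ = 0
  · rw [← neg_sub z z⁻¹, h0]
    simp
  · rw [mul_div_cancel_right₀ _ h0]

/-- The Vandermonde determinant for monic polynomials listed by decreasing degree. -/
theorem det_eval_monic_rev {R : Type*} [CommRing R] {n : ℕ} (e : Fin n → R)
    (p : ℕ → Polynomial R) (hp : ∀ k, (p k).Monic ∧ (p k).natDegree = k) :
    (Matrix.of fun i j : Fin n => (p (n - 1 - i)).eval (e j)).det =
      ∏ j, ∏ k ∈ Ioi j, (e j - e k) := by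
  have h := Matrix.det_eval_matrixOfPolynomials_eq_det_vandermonde (fun i => e (Fin.rev i))
    (fun i => p i) (fun i => (hp i).2) (fun i => (hp i).1)
  rw [Matrix.det_vandermonde] at h
  rw [← Matrix.det_submatrix_equiv_self Fin.revPerm, ← Matrix.det_transpose]
  have hM : ((Matrix.of fun i j : Fin n => (p (n - 1 - i)).eval (e j)).submatrix
      Fin.revPerm Fin.revPerm).transpose =
      Matrix.of fun i j : Fin n => (p j).eval (e (Fin.rev i)) := by
    ext i j
    have hj : n - 1 - (n - ((j : ℕ) + 1)) = j := by omega
    simp [Fin.val_rev, hj]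
  rw [hM, ← h, ← Equiv.prod_comp Fin.revPerm]
  rw [Finset.prod_comm' (t' := univ) (s' := fun k => Ioi (Fin.rev k))]
  · refine (Equiv.prod_comp Fin.revPerm _).symm.trans ?_
    simp
  · intro j k
    simp only [mem_univ, mem_Ioi, true_and, and_true, Fin.revPerm_apply]
    exact Fin.rev_lt_iff

theorem DeltaC_eq_prod_mul_det {n : ℕ} {z : Fin n → ℂ} (hz : ∀ i, z i ≠ 0) :
    DeltaC n z = (∏ i, ((z i)⁻¹ - z i)) *
      (Matrix.of fun i j : Fin n =>
        (Polynomial.Chebyshev.S ℂ ((n - 1 - i : ℕ) : ℤ)).eval (z j + (z j)⁻¹)).det := by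
  rw [det_eval_monic_rev (fun j => z j + (z j)⁻¹) (fun k => Polynomial.Chebyshev.S ℂ k)
    (monic_natDegree_chebyshev_S ℂ), DeltaC]
  congr 1
  · refine prod_congr rfl fun i _ => ?_
    have := hz i
    field_simp
  · refine prod_congr rfl fun j _ => prod_congr rfl fun k _ => ?_
    have := hz j
    have := hz k
    field_simp
    ring

theorem gSummand_eq_det_jSummand {q : ℝ} (hq : q ≠ 0) {n : ℕ} (a α : Fin (2 * n + 2) → ℂ)
    {x : Fin n → ℂ} (hx : ∀ i, x i ≠ 0) (ν : Fin n → ℤ) :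
    gSummand q n a α x ν = (Matrix.of fun i j : Fin n =>
      jSummand q n a α (chiC (n - 1 - (i : ℕ))) (x j) (ν j)).det := by
  have hz : ∀ i, (q : ℂ) ^ ν i * x i ≠ 0 := fun i =>
    mul_ne_zero (zpow_ne_zero _ (Complex.ofReal_ne_zero.2 hq)) (hx i)
  have hΦ : PhiGLat q n a α x ν = ∏ j, PhiLat q n a α (x j) (ν j) := by
    refine prod_congr rfl fun j _ => prod_congr rfl fun m _ => ?_
    rw [mul_comm (a m) (_ * _), div_eq_mul_inv ((q : ℂ) * _),
      mul_right_comm (q : ℂ)]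
  rw [gSummand, hΦ, DeltaC_eq_prod_mul_det hz, ← mul_assoc, ← prod_mul_distrib,
    ← Matrix.det_mul_row]
  congr 1
  ext i j
  simp only [Matrix.of_apply, jSummand]
  linear_combination -PhiLat q n a α (x j) (ν j) * chiC_mul_inv_sub (hz j) (n - 1 - i)

theorem prod_ThetaBC_mul_prod_th {q : ℝ} {n : ℕ} (a α : Fin (2 * n + 2) → ℂ) {x : Fin n → ℂ}
    (hx : ∀ i, x i ≠ 0) :
    (∏ j, ThetaBC q n a α (x j)) *
        ∏ j, ∏ k ∈ Ioi j, (th q (x j / x k) * th q (x j * x k) / x j) =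
      ThetaG q n a α x := by
  rw [ThetaG]
  simp only [prod_div_distrib _ (fun _ => x _), prod_const, Fin.card_Ioi]
  rw [prod_div_distrib, mul_div_assoc', mul_div_right_comm, ← prod_div_distrib]
  congr 1
  refine prod_congr rfl fun j _ => ?_
  have hpow : x j ^ ((n : ℂ) - ∑ m, α m) =
      x j ^ (((j : ℕ) + 1 : ℂ) - ∑ m, α m) * x j ^ (n - 1 - (j : ℕ)) := by
    rw [← Complex.cpow_natCast, ← Complex.cpow_add _ _ (hx j)]
    congr 1
    have hj := j.isLt
    have hn : ((j : ℕ) + 1 : ℂ) + ((n - 1 - (j : ℕ) : ℕ) : ℂ) = n := by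
      norm_cast
      omega
    linear_combination -hn
  have := pow_ne_zero (n - 1 - (j : ℕ)) (hx j)
  rw [ThetaBC, hpow, div_right_comm]
  congr 1
  field_simp

/-- `det(⟨⟨χ_{(n-i)}, x_j⟩⟩)_{1≤i,j≤n}
= ⟨⟨1,x⟩⟩_G ⋅ ∏_{j<k} θ(x_j/x_k) θ(x_j x_k)/x_j`. -/
theorem stmt8 (q : ℝ) (hq0 : 0 < q) (hq1 : q < 1) (n : ℕ) (hn : 1 ≤ n)
    (a α : Fin (2 * n + 2) → ℂ) (ha : ∀ m, a m = (q : ℂ) ^ α m)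
    (x : Fin n → ℂ) (hx : ∀ i, x i ≠ 0)
    (hconvBC : ∀ i j : Fin n, Summable fun ν : ℤ =>
      ‖jSummand q n a α (chiC (n - 1 - (i : ℕ))) (x j) ν‖)
    (hconvG : Summable fun ν : Fin n → ℤ => ‖gSummand q n a α x ν‖)
    (hΘ : ∀ j, ThetaBC q n a α (x j) ≠ 0)
    (hΘG : ThetaG q n a α x ≠ 0) :
    (Matrix.of fun i j : Fin n =>
        jInt q n a α (chiC (n - 1 - (i : ℕ))) (x j) / ThetaBC q n a α (x j)).det =
      gInt q n a α x / ThetaG q n a α x *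
        ∏ j, ∏ k ∈ Ioi j, (th q (x j / x k) * th q (x j * x k) / x j) := by
  have hdet : (Matrix.of fun i j : Fin n => jInt q n a α (chiC (n - 1 - (i : ℕ))) (x j)).det =
      gInt q n a α x := by
    have h := Matrix.det_smul (Matrix.of fun i j : Fin n =>
      ∑' ν : ℤ, jSummand q n a α (chiC (n - 1 - (i : ℕ))) (x j) ν) (1 - (q : ℂ))
    rw [det_tsum_eq_tsum_det hconvBC, Fintype.card_fin] at h
    simp only [gInt, gSummand_eq_det_jSummand hq0.ne' a α hx]
    exact h
  have hM : (Matrix.of fun i j : Fin n =>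
      jInt q n a α (chiC (n - 1 - (i : ℕ))) (x j) / ThetaBC q n a α (x j)) =
      Matrix.of fun i j : Fin n => (ThetaBC q n a α (x j))⁻¹ *
        Matrix.of (fun i j : Fin n => jInt q n a α (chiC (n - 1 - (i : ℕ))) (x j)) i j := by
    ext i j
    simp [div_eq_inv_mul]
  have hΘprod := prod_ThetaBC_mul_prod_th (q := q) a α hx
  have hB : ∏ j, ThetaBC q n a α (x j) ≠ 0 := prod_ne_zero_iff.2 fun j _ => hΘ j
  have hT := right_ne_zero_of_mul (hΘprod.trans_ne hΘG)
  rw [hM, Matrix.det_mul_row, hdet, prod_inv_distrib, ← hΘprod]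
  field_simp
end
end
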